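/- arXiv:1907.00210 — 4 statements merged into one kernel-verified Lean document; each statement's English description precedes it below -/
import Mathlib

section
/- Let p, q, d be positive integers with d ≥ 2, and let T_d denote the infinite d-regular tree. Maker has a winning strategy in the (p,q)-percolation game on T_d (with any vertex chosen as the root) if and only if p(d−2) ≥ q. -/
/-! ### Core definitions for the `(p,q)`-percolation game

Two players, Maker and Breaker, play in alternating turns on an infinite connected
graph `G` with root `v₀`, Maker playing first.  On each of her turns Maker marks `p`
as-yet-unclaimed edges as safe, while on each of his turns Breaker deletes `q`
as-yet-unclaimed edges.  Breaker wins if at some time the connected component of `v₀`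
(in `G` with Breaker's edges deleted) is finite; Maker wins if she can keep it
infinite forever. -/

namespace PercGame

/-- A positional strategy: given the sets of edges claimed so far by Maker and by
Breaker, produce the finite set of edges to claim next. -/
abbrev Strategy (V : Type) : Type := Finset (Sym2 V) → Finset (Sym2 V) → Finset (Sym2 V)

variable {V : Type} [DecidableEq V]

/-- Maker legally claims exactly `p` as-yet-unclaimed edges of `G` on each turn. -/
def MakerLegal (G : SimpleGraph V) (p : ℕ) (σ : Strategy V) : Prop :=
  ∀ M B : Finset (Sym2 V),
    (σ M B).card = p ∧ ↑(σ M B) ⊆ G.edgeSet ∧ Disjoint (σ M B) (M ∪ B)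

/-- Breaker legally deletes exactly `q` as-yet-unclaimed edges of `G` on each turn. -/
def BreakerLegal (G : SimpleGraph V) (q : ℕ) (τ : Strategy V) : Prop :=
  ∀ M B : Finset (Sym2 V),
    (τ M B).card = q ∧ ↑(τ M B) ⊆ G.edgeSet ∧ Disjoint (τ M B) (M ∪ B)

/-- The position (Maker's safe edges, Breaker's deleted edges) after `n` full rounds of
play starting from the position `init`; Maker moves first in every round. -/
def play (σ τ : Strategy V) (init : Finset (Sym2 V) × Finset (Sym2 V)) :
    ℕ → Finset (Sym2 V) × Finset (Sym2 V)
  | 0 => init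
  | n + 1 =>
    let P := play σ τ init n
    let M := P.1 ∪ σ P.1 P.2
    (M, P.2 ∪ τ M P.2)

/-- The vertex set of the connected component of `v₀` in `G` after deleting the edges
in `B`. -/
def comp (G : SimpleGraph V) (v₀ : V) (B : Finset (Sym2 V)) : Set V :=
  {w : V | (G.deleteEdges (↑B : Set (Sym2 V))).Reachable v₀ w}

/-- Maker has a winning strategy in the `(p,q)`-percolation game on `(G, v₀)`:
she can ensure that `v₀` lies in an infinite component at all times. -/
def MakerWins (G : SimpleGraph V) (v₀ : V) (p q : ℕ) : Prop :=
  ∃ σ : Strategy V, MakerLegal G p σ ∧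
    ∀ τ : Strategy V, BreakerLegal G q τ →
      ∀ n : ℕ, (comp G v₀ (play σ τ (∅, ∅) n).2).Infinite

/-- Breaker has a winning strategy in the `(p,q)`-percolation game on `(G, v₀)`:
he can ensure that at some time the component of `v₀` becomes finite. -/
def BreakerWins (G : SimpleGraph V) (v₀ : V) (p q : ℕ) : Prop :=
  ∃ τ : Strategy V, BreakerLegal G q τ ∧
    ∀ σ : Strategy V, MakerLegal G p σ →
      ∃ n : ℕ, (comp G v₀ (play σ τ (∅, ∅) n).2).Finite

end PercGame

namespace PercGame

/-- A presentation of a `d`-regular graph as a tree rooted at `v₀`: every vertex other than the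
root has a parent, and the edges are exactly the parent-child pairs. -/
structure Rooting {V : Type} (T : SimpleGraph V) (v₀ : V) (d : ℕ) where
  par : V → V
  kids : V → Finset V
  mem_kids : ∀ v w, w ∈ kids v ↔ w ≠ v₀ ∧ par w = v
  card_kids_root : (kids v₀).card = d
  card_kids : ∀ v, v ≠ v₀ → (kids v).card + 1 = d
  adj_iff : ∀ u w, T.Adj u w ↔ (u ≠ v₀ ∧ par u = w) ∨ (w ≠ v₀ ∧ par w = u)
  par_par_ne : ∀ v, v ≠ v₀ → par (par v) ≠ v

theorem exists_rooting {V : Type} {T : SimpleGraph V} {d : ℕ} (hd : d ≠ 0)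
    (hconn : T.Connected) (hacyc : T.IsAcyclic)
    (hreg : ∀ v : V, (T.neighborSet v).ncard = d) (v₀ : V) :
    Nonempty (Rooting T v₀ d) := by
  classical
  choose P hP using fun v => hconn.exists_isPath v₀ v
  have hadj : ∀ v, v ≠ v₀ → T.Adj (P v).penultimate v := fun v hv =>
    (P v).adj_penultimate (SimpleGraph.Walk.not_nil_of_ne hv.symm)
  have hroot : ∀ w, w ∈ (P v₀).support → w = v₀ := by
    intro w hw
    simpa [SimpleGraph.Walk.nil_iff_support_eq.1 (SimpleGraph.Walk.isPath_iff_nil.1 (hP v₀))]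
      using hw
  have hpp : ∀ v, v ≠ v₀ → (P (P v).penultimate).penultimate ≠ v := by
    intro v hv h
    refine hacyc.ne_mem_support_of_support_of_adj_of_isPath (hP v) (hP (P v).penultimate)
      (hadj v hv).symm (SimpleGraph.Walk.getVert_mem_support _ _) ?_
    have hmem : (P (P v).penultimate).penultimate ∈ (P (P v).penultimate).support :=
      SimpleGraph.Walk.getVert_mem_support _ _
    rwa [h] at hmem
  have hiff : ∀ u w, T.Adj u w ↔
      (u ≠ v₀ ∧ (P u).penultimate = w) ∨ (w ≠ v₀ ∧ (P w).penultimate = u) := by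
    intro u w
    constructor
    · intro h
      by_cases hu : w ∈ (P u).support
      · left
        refine ⟨?_, (hacyc.eq_penultimate_of_adj_end (hP u) h hu).symm⟩
        rintro rfl
        exact h.ne (hroot w hu).symm
      · right
        have hw := hacyc.mem_support_of_ne_mem_support_of_adj_of_isPath (hP w) (hP u) h.symm hu
        refine ⟨?_, (hacyc.eq_penultimate_of_adj_end (hP w) h.symm hw).symm⟩
        rintro rfl
        exact h.ne (hroot u hw)
    · rintro (⟨hu, rfl⟩ | ⟨hw, rfl⟩)
      · exact (hadj u hu).symm
      · exact hadj w hw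
  have hfin : ∀ v, (T.neighborSet v).Finite := fun v =>
    Set.finite_of_ncard_ne_zero (by rw [hreg]; exact hd)
  have hkfin : ∀ v, {w | w ≠ v₀ ∧ (P w).penultimate = v}.Finite := fun v =>
    (hfin v).subset fun w hw => (hiff v w).2 (Or.inr hw)
  refine ⟨⟨fun v => (P v).penultimate, fun v => (hkfin v).toFinset, by simp, ?_, ?_, hiff, hpp⟩⟩
  · rw [← Set.ncard_eq_toFinset_card _ (hkfin _), ← hreg v₀]
    congr 1
    ext w
    simp [hiff v₀ w]
  · intro v hv
    rw [← Set.ncard_eq_toFinset_card _ (hkfin _), ← hreg v]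
    have : T.neighborSet v = insert (P v).penultimate {w | w ≠ v₀ ∧ (P w).penultimate = v} := by
      ext w
      simp [hiff v w, hv, eq_comm]
    rw [this, Set.ncard_insert_of_notMem _ (hkfin v)]
    exact fun h => hpp v hv h.2

variable {V : Type} {T : SimpleGraph V} {v₀ : V} {d : ℕ}

namespace Rooting

/-- The edge joining a vertex to its parent. -/
def edge (R : Rooting T v₀ d) (v : V) : Sym2 V := s(v, R.par v)

theorem edge_mem (R : Rooting T v₀ d) {v : V} (hv : v ≠ v₀) : R.edge v ∈ T.edgeSet :=
  (R.adj_iff _ _).2 (Or.inl ⟨hv, rfl⟩)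

theorem edge_injOn (R : Rooting T v₀ d) : Set.InjOn R.edge {v | v ≠ v₀} := by
  intro u hu w hw h
  rcases Sym2.eq_iff.1 h with h | h
  · exact h.1
  · exact absurd ((congrArg R.par h.2).trans h.1.symm) (R.par_par_ne u hu)

/-- The vertices joined to the root by edges of `M`. -/
inductive Cluster (R : Rooting T v₀ d) (M : Finset (Sym2 V)) : V → Prop
  | root : Cluster R M v₀
  | step (w : V) : w ≠ v₀ → Cluster R M (R.par w) → R.edge w ∈ M → Cluster R M w

theorem Cluster.of_ne {R : Rooting T v₀ d} {M : Finset (Sym2 V)} {w : V} (h : R.Cluster M w)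
    (hw : w ≠ v₀) : R.Cluster M (R.par w) ∧ R.edge w ∈ M := by
  cases h with
  | root => exact absurd rfl hw
  | step _ _ h1 h2 => exact ⟨h1, h2⟩

theorem Cluster.mono {R : Rooting T v₀ d} {M N : Finset (Sym2 V)} (hMN : M ⊆ N) {w : V}
    (h : R.Cluster M w) : R.Cluster N w := by
  induction h with
  | root => exact .root
  | step w hw _ he ih => exact .step w hw ih (hMN he)

theorem finite_cluster (R : Rooting T v₀ d) (M : Finset (Sym2 V)) :
    {w | R.Cluster M w}.Finite := by
  have h : {w | w ≠ v₀ ∧ R.edge w ∈ M}.Finite :=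
    Set.Finite.of_finite_image (M.finite_toSet.subset (by rintro _ ⟨w, hw, rfl⟩; exact hw.2))
      (R.edge_injOn.mono fun w hw => hw.1)
  refine (h.insert v₀).subset fun w hw => ?_
  by_cases h0 : w = v₀
  · exact Or.inl h0
  · exact Or.inr ⟨h0, (Cluster.of_ne hw h0).2⟩

/-- The cluster of the root as a finite set. -/
noncomputable def cluster (R : Rooting T v₀ d) (M : Finset (Sym2 V)) : Finset V :=
  (R.finite_cluster M).toFinset

@[simp] theorem mem_cluster {R : Rooting T v₀ d} {M : Finset (Sym2 V)} {w : V} :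
    w ∈ R.cluster M ↔ R.Cluster M w := by simp [cluster]

theorem root_mem_cluster (R : Rooting T v₀ d) (M : Finset (Sym2 V)) : v₀ ∈ R.cluster M :=
  mem_cluster.2 .root

theorem cluster_subset_comp (R : Rooting T v₀ d) {M B : Finset (Sym2 V)} (h : Disjoint M B) :
    ↑(R.cluster M) ⊆ comp T v₀ B := by
  intro w hw
  rw [Finset.mem_coe, mem_cluster] at hw
  induction hw with
  | root => exact SimpleGraph.Reachable.refl _
  | step w h0 _ he ih =>
    refine SimpleGraph.Reachable.trans ih (SimpleGraph.Adj.reachable (SimpleGraph.Adj.symm ?_))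
    rw [SimpleGraph.deleteEdges_adj]
    exact ⟨(R.adj_iff _ _).2 (Or.inl ⟨h0, rfl⟩), Finset.disjoint_left.1 h he⟩

theorem infinite_edgeSet [Infinite V] (R : Rooting T v₀ d) : T.edgeSet.Infinite := by
  have h : ({v | v ≠ v₀} : Set V).Infinite := (Set.finite_singleton v₀).infinite_compl
  exact (h.image R.edge_injOn).mono (by rintro _ ⟨v, hv, rfl⟩; exact R.edge_mem hv)

/-- From any position, there are `k` unclaimed edges. -/
theorem exists_legal [Infinite V] (R : Rooting T v₀ d) (k : ℕ) (F : Finset (Sym2 V)) :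
    ∃ N : Finset (Sym2 V), N.card = k ∧ ↑N ⊆ T.edgeSet ∧ Disjoint N F := by
  obtain ⟨N, hN, hk⟩ := (R.infinite_edgeSet.sdiff F.finite_toSet).exists_subset_card_eq k
  exact ⟨N, hk, fun e he => (hN he).1, Finset.disjoint_left.2 fun e he => (hN he).2⟩

variable [DecidableEq V]

theorem card_cluster_le (R : Rooting T v₀ d) (M : Finset (Sym2 V)) :
    (R.cluster M).card ≤ M.card + 1 := by
  rw [← Finset.card_erase_add_one (R.root_mem_cluster M)]
  refine Nat.succ_le_succ (Finset.card_le_card_of_injOn R.edge ?_ ?_)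
  · intro w hw
    simp only [Finset.coe_erase, Set.mem_sdiff, Finset.mem_coe, mem_cluster] at hw
    exact (hw.1.of_ne hw.2).2
  · exact R.edge_injOn.mono fun w hw => Finset.ne_of_mem_erase hw

/-- The vertices outside the cluster of the root whose parent lies in it. -/
noncomputable def border (R : Rooting T v₀ d) (M : Finset (Sym2 V)) : Finset V :=
  (R.cluster M).biUnion R.kids \ R.cluster M

theorem mem_border {R : Rooting T v₀ d} {M : Finset (Sym2 V)} {w : V} :
    w ∈ R.border M ↔ w ≠ v₀ ∧ R.Cluster M (R.par w) ∧ R.edge w ∉ M := by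
  simp only [border, Finset.mem_sdiff, Finset.mem_biUnion, mem_cluster, R.mem_kids]
  constructor
  · rintro ⟨⟨v, hv, h0, rfl⟩, h⟩
    exact ⟨h0, hv, fun he => h (.step w h0 hv he)⟩
  · rintro ⟨h0, hv, he⟩
    exact ⟨⟨_, hv, h0, rfl⟩, fun h => he (h.of_ne h0).2⟩

theorem card_border (R : Rooting T v₀ d) (hd : 2 ≤ d) (M : Finset (Sym2 V)) :
    (R.border M).card = d + (d - 2) * ((R.cluster M).card - 1) := by
  have hdisj : ((R.cluster M : Finset V) : Set V).PairwiseDisjoint R.kids := by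
    intro u _ v _ huv
    refine Finset.disjoint_left.2 fun w hu hv => huv ?_
    rw [R.mem_kids] at hu hv
    exact hu.2.symm.trans hv.2
  have hroot := R.root_mem_cluster M
  have hkids : ((R.cluster M).biUnion R.kids).card
      = d + ((R.cluster M).card - 1) * (d - 1) := by
    rw [Finset.card_biUnion hdisj, ← Finset.add_sum_erase _ _ hroot, R.card_kids_root,
      Finset.sum_const_nat (m := d - 1), Finset.card_erase_of_mem hroot]
    intro v hv
    have := R.card_kids v (Finset.ne_of_mem_erase hv)
    omega
  have hinter : R.cluster M ∩ (R.cluster M).biUnion R.kids = (R.cluster M).erase v₀ := by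
    ext w
    simp only [Finset.mem_inter, Finset.mem_biUnion, mem_cluster, R.mem_kids, Finset.mem_erase]
    constructor
    · rintro ⟨h, v, -, h0, -⟩
      exact ⟨h0, h⟩
    · rintro ⟨h0, h⟩
      exact ⟨h, _, (h.of_ne h0).1, h0, rfl⟩
  rw [border, Finset.card_sdiff, hinter, hkids, Finset.card_erase_of_mem hroot]
  obtain ⟨e, rfl⟩ := Nat.exists_eq_add_of_le' hd
  simp only [Nat.add_sub_cancel, Nat.add_succ_sub_one]
  generalize (R.cluster M).card - 1 = k
  rw [Nat.mul_succ, mul_comm e k]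
  omega

/-- The edges leaving the cluster of the root. -/
noncomputable def frontier (R : Rooting T v₀ d) (M : Finset (Sym2 V)) : Finset (Sym2 V) :=
  (R.border M).image R.edge

theorem card_frontier (R : Rooting T v₀ d) (hd : 2 ≤ d) (M : Finset (Sym2 V)) :
    (R.frontier M).card = d + (d - 2) * ((R.cluster M).card - 1) := by
  rw [frontier, Finset.card_image_of_injOn, card_border R hd]
  exact R.edge_injOn.mono fun w hw => (mem_border.1 hw).1

theorem mem_frontier {R : Rooting T v₀ d} {M : Finset (Sym2 V)} {e : Sym2 V} :
    e ∈ R.frontier M ↔ ∃ w, (w ≠ v₀ ∧ R.Cluster M (R.par w) ∧ R.edge w ∉ M) ∧ R.edge w = e := by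
  simp [frontier, mem_border]

theorem frontier_subset_edgeSet (R : Rooting T v₀ d) (M : Finset (Sym2 V)) :
    ↑(R.frontier M) ⊆ T.edgeSet := by
  intro e he
  obtain ⟨w, hw, rfl⟩ := mem_frontier.1 he
  exact R.edge_mem hw.1

theorem disjoint_frontier (R : Rooting T v₀ d) (M : Finset (Sym2 V)) :
    Disjoint (R.frontier M) M := by
  refine Finset.disjoint_left.2 fun e he => ?_
  obtain ⟨w, hw, rfl⟩ := mem_frontier.1 he
  exact hw.2.2

theorem mem_frontier_mono {R : Rooting T v₀ d} {M N : Finset (Sym2 V)} (hMN : M ⊆ N)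
    {e : Sym2 V} (he : e ∈ R.frontier M) (heN : e ∉ N) : e ∈ R.frontier N := by
  obtain ⟨w, hw, rfl⟩ := mem_frontier.1 he
  exact mem_frontier.2 ⟨w, ⟨hw.1, hw.2.1.mono hMN, heN⟩, rfl⟩

theorem comp_subset_cluster (R : Rooting T v₀ d) {M B : Finset (Sym2 V)}
    (h : R.frontier M ⊆ B) : comp T v₀ B ⊆ R.cluster M := by
  rintro w ⟨p⟩
  suffices ∀ u w, (T.deleteEdges (B : Set (Sym2 V))).Walk u w → R.Cluster M u → R.Cluster M w from
    mem_cluster.2 (this _ _ p .root)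
  intro u w p
  induction p with
  | nil => exact id
  | @cons u v w huv _ ih =>
    intro hu
    apply ih
    rw [SimpleGraph.deleteEdges_adj] at huv
    rcases (R.adj_iff u v).1 huv.1 with ⟨h0, rfl⟩ | ⟨h0, rfl⟩
    · exact (hu.of_ne h0).1
    · by_contra hv
      refine huv.2 (h (mem_frontier.2 ⟨v, ⟨h0, hu, fun he => hv (.step v h0 hu he)⟩, ?_⟩))
      exact Sym2.eq_swap

/-- While Breaker has deleted few edges, Maker can enlarge the cluster of the root by one vertex
per move. -/
theorem exists_extension (R : Rooting T v₀ d) (hd : 2 ≤ d) (B : Finset (Sym2 V)) (k : ℕ) :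
    ∀ M : Finset (Sym2 V), B.card < d + (d - 2) * ((R.cluster M).card - 1) →
      ∃ N : Finset (Sym2 V), N.card = k ∧ ↑N ⊆ T.edgeSet ∧ Disjoint N (M ∪ B) ∧
        (R.cluster M).card + k ≤ (R.cluster (M ∪ N)).card := by
  induction k with
  | zero => exact fun M _ => ⟨∅, by simp⟩
  | succ k ih =>
    intro M hB
    rw [← card_frontier R hd] at hB
    obtain ⟨e, he, heB⟩ := Finset.exists_mem_notMem_of_card_lt_card hB
    obtain ⟨w, ⟨h0, hpar, hM⟩, rfl⟩ := mem_frontier.1 he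
    have hgrow : (R.cluster M).card + 1 ≤ (R.cluster (insert (R.edge w) M)).card := by
      have hw : w ∉ R.cluster M := fun h => hM ((mem_cluster.1 h).of_ne h0).2
      rw [← Finset.card_insert_of_notMem hw]
      refine Finset.card_le_card fun x hx => mem_cluster.2 ?_
      rcases Finset.mem_insert.1 hx with rfl | hx
      · exact .step x h0 (hpar.mono (Finset.subset_insert _ _)) (Finset.mem_insert_self _ _)
      · exact (mem_cluster.1 hx).mono (Finset.subset_insert _ _)
    rw [card_frontier R hd] at hB
    obtain ⟨N, hk, hN, hdisj, hcard⟩ := ih (insert (R.edge w) M) <| hB.trans_le <|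
      Nat.add_le_add_left (Nat.mul_le_mul_left _ (by omega)) _
    rw [Finset.disjoint_left] at hdisj
    refine ⟨insert (R.edge w) N, ?_, ?_, ?_, ?_⟩
    · rw [Finset.card_insert_of_notMem, hk]
      intro h
      exact hdisj h (by simp)
    · rw [Finset.coe_insert]
      exact Set.insert_subset (R.edge_mem h0) hN
    · rw [Finset.disjoint_left]
      intro e he
      rcases Finset.mem_insert.1 he with rfl | he
      · simp [hM, heB]
      · have := hdisj he
        simp only [Finset.mem_union, Finset.mem_insert, not_or] at this ⊢
        exact ⟨this.1.2, this.2⟩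
    · rw [Finset.union_insert, ← Finset.insert_union]
      omega

end Rooting

theorem comp_antitone (G : SimpleGraph V) (v : V) : Antitone (comp G v) := fun _ _ h _ hw =>
  hw.mono (SimpleGraph.deleteEdges_anti (Finset.coe_subset.2 h))

variable [DecidableEq V]

theorem play_fst_mono (σ τ : Strategy V) (init : Finset (Sym2 V) × Finset (Sym2 V)) (n : ℕ) :
    (play σ τ init n).1 ⊆ (play σ τ init (n + 1)).1 := Finset.subset_union_left

theorem play_snd_mono (σ τ : Strategy V) (init : Finset (Sym2 V) × Finset (Sym2 V)) :
    Monotone fun n => (play σ τ init n).2 :=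
  monotone_nat_of_le_succ fun _ => Finset.subset_union_left

section Play

variable {G : SimpleGraph V} {p q : ℕ} {σ τ : Strategy V}

theorem disjoint_play (hσ : MakerLegal G p σ) (hτ : BreakerLegal G q τ) (n : ℕ) :
    Disjoint (play σ τ (∅, ∅) n).1 (play σ τ (∅, ∅) n).2 := by
  induction n with
  | zero => simp [play]
  | succ n ih =>
    have h1 := Finset.disjoint_union_right.1 (hσ (play σ τ (∅, ∅) n).1 (play σ τ (∅, ∅) n).2).2.2
    have h2 := Finset.disjoint_union_right.1
      (hτ (play σ τ (∅, ∅) (n + 1)).1 (play σ τ (∅, ∅) n).2).2.2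
    exact Finset.disjoint_union_right.2 ⟨Finset.disjoint_union_left.2 ⟨ih, h1.2⟩, h2.1.symm⟩

theorem card_play_fst_le (hσ : MakerLegal G p σ) (n : ℕ) :
    (play σ τ (∅, ∅) n).1.card ≤ n * p := by
  induction n with
  | zero => simp [play]
  | succ n ih =>
    have h := (hσ (play σ τ (∅, ∅) n).1 (play σ τ (∅, ∅) n).2).1
    refine (Finset.card_union_le _ _).trans ?_
    rw [h, Nat.succ_mul]
    exact Nat.add_le_add_right ih p

theorem card_play_snd (hτ : BreakerLegal G q τ) (n : ℕ) :
    (play σ τ (∅, ∅) n).2.card = n * q := by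
  induction n with
  | zero => simp [play]
  | succ n ih =>
    have h := hτ (play σ τ (∅, ∅) (n + 1)).1 (play σ τ (∅, ∅) n).2
    have hd := (Finset.disjoint_union_right.1 h.2.2).2
    refine (Finset.card_union_of_disjoint hd.symm).trans ?_
    rw [ih, h.1, Nat.succ_mul]

end Play

theorem Rooting.makerWins [Infinite V] (R : Rooting T v₀ d) (hd : 2 ≤ d) {p q : ℕ} (hp : 1 ≤ p)
    (hpq : q ≤ p * (d - 2)) : MakerWins T v₀ p q := by
  have key : ∀ M B : Finset (Sym2 V), ∃ N : Finset (Sym2 V),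
      (N.card = p ∧ ↑N ⊆ T.edgeSet ∧ Disjoint N (M ∪ B)) ∧
      (B.card < d + (d - 2) * ((R.cluster M).card - 1) →
        (R.cluster M).card + p ≤ (R.cluster (M ∪ N)).card) := by
    intro M B
    by_cases h : B.card < d + (d - 2) * ((R.cluster M).card - 1)
    · obtain ⟨N, h1, h2, h3, h4⟩ := R.exists_extension hd B p M h
      exact ⟨N, ⟨h1, h2, h3⟩, fun _ => h4⟩
    · obtain ⟨N, hN⟩ := R.exists_legal p (M ∪ B)
      exact ⟨N, hN, fun hc => absurd hc h⟩
  choose σ hσ hgrow using key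
  refine ⟨σ, hσ, fun τ hτ n => ?_⟩
  have hcard : ∀ m, m * p + 1 ≤ (R.cluster (play σ τ (∅, ∅) m).1).card := by
    intro m
    induction m with
    | zero => simpa using ⟨v₀, R.root_mem_cluster _⟩
    | succ m ih =>
      refine le_trans ?_ (hgrow (play σ τ (∅, ∅) m).1 (play σ τ (∅, ∅) m).2 ?_)
      · rw [Nat.succ_mul]
        omega
      · rw [card_play_snd hτ]
        calc m * q ≤ m * (p * (d - 2)) := Nat.mul_le_mul_left _ hpq
          _ = (d - 2) * (m * p) := by ring
          _ ≤ (d - 2) * ((R.cluster (play σ τ (∅, ∅) m).1).card - 1) :=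
            Nat.mul_le_mul_left _ (by omega)
          _ < _ := by omega
  intro hfin
  have hle : ∀ m, n ≤ m → m * p + 1 ≤ (comp T v₀ (play σ τ (∅, ∅) n).2).ncard := by
    intro m hm
    refine (hcard m).trans ?_
    rw [← Set.ncard_coe_finset]
    exact Set.ncard_le_ncard ((R.cluster_subset_comp (disjoint_play hσ hτ m)).trans
      (comp_antitone T v₀ (play_snd_mono σ τ _ hm))) hfin
  have := hle (n + (comp T v₀ (play σ τ (∅, ∅) n).2).ncard) (by omega)
  have := Nat.le_mul_of_pos_right (n + (comp T v₀ (play σ τ (∅, ∅) n).2).ncard) hp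
  omega

theorem Rooting.breakerWins [Infinite V] (R : Rooting T v₀ d) (hd : 2 ≤ d) {p q : ℕ}
    (hpq : p * (d - 2) < q) : BreakerWins T v₀ p q := by
  have key : ∀ M B : Finset (Sym2 V), ∃ N : Finset (Sym2 V),
      (N.card = q ∧ ↑N ⊆ T.edgeSet ∧ Disjoint N (M ∪ B)) ∧
      (N ⊆ R.frontier M ∨ R.frontier M ⊆ B ∪ N) := by
    intro M B
    have hA : Disjoint (R.frontier M \ B) (M ∪ B) := Finset.disjoint_union_right.2
      ⟨(R.disjoint_frontier M).mono_left Finset.sdiff_subset, Finset.sdiff_disjoint⟩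
    have hAe : ((R.frontier M \ B : Finset (Sym2 V)) : Set (Sym2 V)) ⊆ T.edgeSet :=
      (Finset.coe_subset.2 Finset.sdiff_subset).trans (R.frontier_subset_edgeSet M)
    rcases le_total q (R.frontier M \ B).card with h | h
    · obtain ⟨N, hN, hq⟩ := Finset.exists_subset_card_eq h
      exact ⟨N, ⟨hq, (Finset.coe_subset.2 hN).trans hAe, hA.mono_left hN⟩,
        Or.inl (hN.trans Finset.sdiff_subset)⟩
    · obtain ⟨N, hq, hN, hdisj⟩ := R.exists_legal (q - (R.frontier M \ B).card)
        ((M ∪ B) ∪ (R.frontier M \ B))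
      rw [Finset.disjoint_union_right] at hdisj
      refine ⟨(R.frontier M \ B) ∪ N, ⟨?_, ?_, Finset.disjoint_union_left.2 ⟨hA, hdisj.1⟩⟩,
        Or.inr ?_⟩
      · rw [Finset.card_union_of_disjoint hdisj.2.symm]
        omega
      · rw [Finset.coe_union]
        exact Set.union_subset hAe hN
      · intro e he
        by_cases heB : e ∈ B <;> simp [he, heB]
  choose τ hτ hcut using key
  refine ⟨τ, hτ, fun σ hσ => ?_⟩
  suffices ∃ n, R.frontier (play σ τ (∅, ∅) n).1 ⊆ (play σ τ (∅, ∅) n).2 by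
    obtain ⟨n, hn⟩ := this
    exact ⟨n, (Finset.finite_toSet _).subset (R.comp_subset_cluster hn)⟩
  by_contra! hno
  have hsub : ∀ n, (play σ τ (∅, ∅) n).2 ⊆ R.frontier (play σ τ (∅, ∅) n).1 := by
    intro n
    induction n with
    | zero => simp [play]
    | succ n ih =>
      have hdisj := disjoint_play hσ hτ (n + 1)
      refine Finset.union_subset (fun e he => ?_) ?_
      · exact Rooting.mem_frontier_mono (play_fst_mono σ τ _ n) (ih he)
          (Finset.disjoint_right.1 hdisj (Finset.mem_union_left _ he))
      · exact (hcut (play σ τ (∅, ∅) (n + 1)).1 (play σ τ (∅, ∅) n).2).resolve_right (hno (n + 1))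
  have h1 := Finset.card_le_card (hsub (d + 1))
  rw [card_play_snd hτ, R.card_frontier hd] at h1
  have h2 : (R.cluster (play σ τ (∅, ∅) (d + 1)).1).card - 1 ≤ (d + 1) * p := by
    have := R.card_cluster_le (play σ τ (∅, ∅) (d + 1)).1
    have := card_play_fst_le (τ := τ) hσ (d + 1)
    omega
  have h3 := Nat.mul_le_mul_left (d - 2) h2
  have h4 := Nat.mul_le_mul_left (d + 1) (Nat.succ_le_of_lt hpq)
  have h5 : (d + 1) * (p * (d - 2) + 1) = (d - 2) * ((d + 1) * p) + (d + 1) := by ring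
  simp only [Nat.succ_eq_add_one] at h4
  omega

theorem BreakerWins.not_makerWins {G : SimpleGraph V} {v : V} {p q : ℕ}
    (h : BreakerWins G v p q) : ¬ MakerWins G v p q := by
  rintro ⟨σ, hσ, hwin⟩
  obtain ⟨τ, hτ, h⟩ := h
  obtain ⟨n, hn⟩ := h σ hσ
  exact hwin τ hτ n hn

end PercGame

/-- **Theorem (percolation game on the infinite `d`-regular tree).**
Let `p, q, d` be positive integers with `d ≥ 2` and let `T` be an infinite `d`-regular
tree (an infinite connected acyclic graph in which every vertex has exactly `d`
neighbours).  Maker has a winning strategy in the `(p,q)`-percolation game on `T`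
(with any vertex chosen as the root) if and only if `p(d-2) ≥ q`. -/
theorem maker_wins_iff_on_regular_tree (d p q : ℕ) (hd : 2 ≤ d) (hp : 1 ≤ p) (hq : 1 ≤ q)
    {V : Type} [DecidableEq V] (T : SimpleGraph V) [Infinite V]
    (hconn : T.Connected) (hacyc : T.IsAcyclic)
    (hreg : ∀ v : V, (T.neighborSet v).ncard = d) (v₀ : V) :
    PercGame.MakerWins T v₀ p q ↔ q ≤ p * (d - 2) := by
  obtain ⟨R⟩ := PercGame.exists_rooting (by omega) hconn hacyc hreg v₀
  refine ⟨fun h => ?_, R.makerWins hd hp⟩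
  by_contra! hlt
  exact (R.breakerWins hd hlt).not_makerWins h
end

section
/- Let p, q, d be positive integers with d ≥ 2 and p(d−2) < q. Then Breaker has a winning strategy in the (p,q)-percolation game on the infinite d-regular tree T_d that guarantees the connected component of the root becomes finite by the end of Breaker's ⌈d/(q − p(d−2))⌉-th turn. -/
namespace PercGame

open Set

variable {V : Type}

/-- The vertices joined to `v₀` by edges of `T` that Maker has marked as safe. -/
def cluster (T : SimpleGraph V) (v₀ : V) (M : Finset (Sym2 V)) : Set V :=
  {w | (SimpleGraph.fromEdgeSet (T.edgeSet ∩ ↑M)).Reachable v₀ w}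

/-- The edges of `T` that are not safe and meet the safe cluster of `v₀`. -/
def frontier (T : SimpleGraph V) (v₀ : V) (M : Finset (Sym2 V)) : Set (Sym2 V) :=
  {e | e ∈ T.edgeSet ∧ e ∉ M ∧ ∃ v ∈ cluster T v₀ M, v ∈ e}

theorem cluster_mono (T : SimpleGraph V) (v₀ : V) {M M' : Finset (Sym2 V)} (h : M ⊆ M') :
    cluster T v₀ M ⊆ cluster T v₀ M' := fun _ hw =>
  SimpleGraph.Reachable.mono
    (SimpleGraph.fromEdgeSet_mono (inter_subset_inter_right _ (Finset.coe_subset.2 h))) hw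

theorem mem_cluster_of_adj {T : SimpleGraph V} {v₀ : V} {M : Finset (Sym2 V)} {u v : V}
    (hu : u ∈ cluster T v₀ M) (huv : T.Adj u v) (hM : s(u, v) ∈ M) :
    v ∈ cluster T v₀ M := by
  refine SimpleGraph.Reachable.trans hu (SimpleGraph.Adj.reachable ?_)
  rw [SimpleGraph.fromEdgeSet_adj]
  exact ⟨⟨huv, hM⟩, huv.ne⟩

/-- A set of vertices containing `v₀` and closed under adjacency contains everything reachable
from `v₀`. -/
theorem mem_of_reachable {G : SimpleGraph V} {v₀ w : V} {C : Set V} (h₀ : v₀ ∈ C)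
    (hC : ∀ u v, u ∈ C → G.Adj u v → v ∈ C) (hw : G.Reachable v₀ w) : w ∈ C := by
  obtain ⟨W⟩ := hw
  induction W with
  | nil => exact h₀
  | cons hadj _ ih => exact ih (hC _ _ h₀ hadj)

theorem incidenceSet_ncard {T : SimpleGraph V} {d : ℕ}
    (hreg : ∀ v : V, (T.neighborSet v).ncard = d) (v : V) : (T.incidenceSet v).ncard = d := by
  classical
  rw [← hreg v]
  exact Nat.card_congr (T.incidenceSetEquivNeighborSet v)

theorem edgeSet_infinite [Infinite V] {T : SimpleGraph V} {d : ℕ} (hd : 2 ≤ d)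
    (hreg : ∀ v : V, (T.neighborSet v).ncard = d) : T.edgeSet.Infinite := by
  intro hfin
  have hsub : (univ : Set V) ⊆ ⋃ e ∈ T.edgeSet, {v | v ∈ e} := by
    intro v _
    have hne : (T.neighborSet v).Nonempty := by
      apply nonempty_of_ncard_ne_zero
      rw [hreg v]
      omega
    obtain ⟨w, hw⟩ := hne
    exact mem_biUnion (x := s(v, w)) hw (Sym2.mem_mk_left v w)
  refine infinite_univ ((hfin.biUnion fun e _ => ?_).subset hsub)
  induction e with
  | _ a b =>
    refine (toFinite {a, b}).subset fun v hv => ?_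
    simpa using hv

/-- Growing a vertex set `C` by one safe edge at a time, recording the edges `F` used, exhausts
the safe cluster. -/
theorem exists_spanning_edges {T : SimpleGraph V} {d : ℕ} (hd : 2 ≤ d)
    (hreg : ∀ v : V, (T.neighborSet v).ncard = d) (v₀ : V) (M : Finset (Sym2 V)) (k : ℕ)
    (C : Set V) (F : Finset (Sym2 V)) (hk : F.card + k = M.card) (hFM : F ⊆ M)
    (h₀ : v₀ ∈ C) (hfin : C.Finite) (hFC : ∀ e ∈ F, ∀ v ∈ e, v ∈ C)
    (hDfin : {e | e ∈ T.edgeSet ∧ e ∉ F ∧ ∃ v ∈ C, v ∈ e}.Finite)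
    (hD : {e | e ∈ T.edgeSet ∧ e ∉ F ∧ ∃ v ∈ C, v ∈ e}.ncard ≤ d + F.card * (d - 2)) :
    ∃ (C' : Set V) (F' : Finset (Sym2 V)), F' ⊆ M ∧ C'.Finite ∧ cluster T v₀ M ⊆ C' ∧
      {e | e ∈ T.edgeSet ∧ e ∉ F' ∧ ∃ v ∈ C', v ∈ e}.Finite ∧
      {e | e ∈ T.edgeSet ∧ e ∉ F' ∧ ∃ v ∈ C', v ∈ e}.ncard ≤ d + F'.card * (d - 2) := by
  classical
  by_cases hcl : ∀ u v, u ∈ C → T.Adj u v → s(u, v) ∈ M → v ∈ C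
  · refine ⟨C, F, hFM, hfin, fun w hw => mem_of_reachable h₀ ?_ hw, hDfin, hD⟩
    intro u v hu huv
    rw [SimpleGraph.fromEdgeSet_adj] at huv
    exact hcl u v hu huv.1.1 huv.1.2
  push Not at hcl
  obtain ⟨u, v, hu, huv, hM, hv⟩ := hcl
  have heF : s(u, v) ∉ F := fun h => hv (hFC _ h v (Sym2.mem_mk_right u v))
  have hcard : (insert s(u, v) F).card = F.card + 1 := Finset.card_insert_of_notMem heF
  have hins : insert s(u, v) F ⊆ M := Finset.insert_subset hM hFM
  have hle := Finset.card_le_card hins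
  have hinc : (T.incidenceSet v).ncard = d := incidenceSet_ncard hreg v
  have hincfin : (T.incidenceSet v).Finite := finite_of_ncard_ne_zero (by omega)
  set D : Set (Sym2 V) := {e | e ∈ T.edgeSet ∧ e ∉ F ∧ ∃ v ∈ C, v ∈ e} with hDdef
  have hsub : {e | e ∈ T.edgeSet ∧ e ∉ insert s(u, v) F ∧ ∃ w ∈ insert v C, w ∈ e} ⊆
      (D \ {s(u, v)}) ∪ (T.incidenceSet v \ {s(u, v)}) := by
    rintro e ⟨heT, he, w, hw, hwe⟩
    rw [Finset.mem_insert, not_or] at he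
    rcases hw with rfl | hw
    · exact Or.inr ⟨⟨heT, hwe⟩, he.1⟩
    · exact Or.inl ⟨⟨heT, he.2, w, hw, hwe⟩, he.1⟩
  have hfin' : ((D \ {s(u, v)}) ∪ (T.incidenceSet v \ {s(u, v)})).Finite :=
    (hDfin.subset sdiff_subset).union (hincfin.subset sdiff_subset)
  obtain ⟨k, rfl⟩ : ∃ j, k = j + 1 := ⟨k - 1, by omega⟩
  refine exists_spanning_edges hd hreg v₀ M k (insert v C) (insert s(u, v) F) (by omega) hins
    (mem_insert_of_mem _ h₀) (hfin.insert v) ?_ (hfin'.subset hsub) ?_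
  · intro e he w hw
    rcases Finset.mem_insert.1 he with rfl | he
    · rcases Sym2.mem_iff.1 hw with rfl | rfl
      · exact mem_insert_of_mem _ hu
      · exact mem_insert _ _
    · exact mem_insert_of_mem _ (hFC e he w hw)
  · have h1 := ncard_le_ncard hsub hfin'
    have h2 := ncard_union_le (D \ {s(u, v)}) (T.incidenceSet v \ {s(u, v)})
    have h3 : (D \ {s(u, v)}).ncard + 1 = D.ncard :=
      ncard_sdiff_singleton_add_one (show s(u, v) ∈ D from ⟨huv, heF, u, hu, Sym2.mem_mk_left u v⟩)
        hDfin
    have h4 : (T.incidenceSet v \ {s(u, v)}).ncard + 1 = (T.incidenceSet v).ncard :=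
      ncard_sdiff_singleton_add_one ⟨huv, Sym2.mem_mk_right u v⟩ hincfin
    rw [hcard, add_mul]
    omega

/-- In a `d`-regular graph the safe cluster is finite, and `m` safe edges leave it at most
`d + m (d - 2)` edges to escape by. -/
theorem frontier_ncard_le {T : SimpleGraph V} {d : ℕ} (hd : 2 ≤ d)
    (hreg : ∀ v : V, (T.neighborSet v).ncard = d) (v₀ : V) (M : Finset (Sym2 V)) :
    (cluster T v₀ M).Finite ∧ (frontier T v₀ M).Finite ∧
      (frontier T v₀ M).ncard ≤ d + M.card * (d - 2) := by
  have hinc : (T.incidenceSet v₀).ncard = d := incidenceSet_ncard hreg v₀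
  have hincfin : (T.incidenceSet v₀).Finite := finite_of_ncard_ne_zero (by omega)
  have hstart : {e | e ∈ T.edgeSet ∧ e ∉ (∅ : Finset (Sym2 V)) ∧ ∃ v ∈ ({v₀} : Set V), v ∈ e} =
      T.incidenceSet v₀ := by
    ext e
    simp [SimpleGraph.incidenceSet]
  obtain ⟨C, F, hFM, hfin, hsub, hDfin, hD⟩ := exists_spanning_edges hd hreg v₀ M M.card {v₀} ∅
    (by simp) (Finset.empty_subset M) rfl (finite_singleton v₀) (by simp)
    (by rwa [hstart]) (by rw [hstart, hinc]; exact Nat.le_add_right _ _)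
  have hfr : frontier T v₀ M ⊆ {e | e ∈ T.edgeSet ∧ e ∉ F ∧ ∃ v ∈ C, v ∈ e} :=
    fun e ⟨heT, heM, v, hv, hve⟩ => ⟨heT, fun h => heM (hFM h), v, hsub hv, hve⟩
  exact ⟨hfin.subset hsub, hDfin.subset hfr, (ncard_le_ncard hfr hDfin).trans
    (hD.trans (by gcongr))⟩

/-- If Breaker holds the whole frontier, then the component of `v₀` is inside the safe cluster. -/
theorem comp_subset_cluster {T : SimpleGraph V} {v₀ : V} {M B : Finset (Sym2 V)}
    (h : frontier T v₀ M ⊆ ↑B) : comp T v₀ B ⊆ cluster T v₀ M := by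
  intro w hw
  refine mem_of_reachable (SimpleGraph.Reachable.refl v₀) (fun u v hu huv => ?_) hw
  rw [SimpleGraph.deleteEdges_adj] at huv
  refine mem_cluster_of_adj hu huv.1 ?_
  by_contra hM
  exact huv.2 (h ⟨huv.1, hM, u, hu, Sym2.mem_mk_left u v⟩)

theorem comp_anti (T : SimpleGraph V) (v₀ : V) {B B' : Finset (Sym2 V)} (h : B ⊆ B') :
    comp T v₀ B' ⊆ comp T v₀ B := fun _ hw =>
  SimpleGraph.Reachable.mono (SimpleGraph.deleteEdges_anti (Finset.coe_subset.2 h)) hw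

/-- Inside an infinite set `X` there are `q` elements that are comparable with a given
subset `A`. -/
theorem exists_card_eq_comparable {α : Type} {X A : Set α} (hX : X.Infinite) (hA : A ⊆ X)
    (q : ℕ) : ∃ S : Finset α, S.card = q ∧ ↑S ⊆ X ∧ (A ⊆ ↑S ∨ ↑S ⊆ A) := by
  classical
  by_cases hfin : A.Finite
  · lift A to Finset α using hfin
    rcases le_total A.card q with hq | hq
    · obtain ⟨S, hSX, hS⟩ :=
        Set.Infinite.exists_subset_card_eq (hX.sdiff A.finite_toSet) (q - A.card)
      have hdisj : Disjoint A S := Finset.disjoint_left.2 fun a ha h => (hSX h).2 ha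
      refine ⟨A ∪ S, ?_, ?_, Or.inl (Finset.coe_subset.2 Finset.subset_union_left)⟩
      · rw [Finset.card_union_of_disjoint hdisj]
        omega
      · rw [Finset.coe_union]
        exact union_subset hA (hSX.trans sdiff_subset)
    · obtain ⟨S, hSA, hS⟩ := Finset.exists_subset_card_eq hq
      exact ⟨S, hS, (Finset.coe_subset.2 hSA).trans hA, Or.inr (Finset.coe_subset.2 hSA)⟩
  · obtain ⟨S, hSA, hS⟩ := Set.Infinite.exists_subset_card_eq hfin q
    exact ⟨S, hS, hSA.trans hA, Or.inr hSA⟩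

/-- Breaker can always play legally inside the frontier, or else claim all that is left of it. -/
theorem exists_frontier_strategy [DecidableEq V] {T : SimpleGraph V} (hT : T.edgeSet.Infinite)
    (v₀ : V) (q : ℕ) : ∃ τ : Strategy V, BreakerLegal T q τ ∧ ∀ M B : Finset (Sym2 V),
      frontier T v₀ M ⊆ ↑(B ∪ τ M B) ∨ ↑(τ M B) ⊆ frontier T v₀ M := by
  have key : ∀ M B : Finset (Sym2 V), ∃ S : Finset (Sym2 V),
      (S.card = q ∧ ↑S ⊆ T.edgeSet ∧ Disjoint S (M ∪ B)) ∧
        (frontier T v₀ M ⊆ ↑(B ∪ S) ∨ ↑S ⊆ frontier T v₀ M) := by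
    intro M B
    have hA : frontier T v₀ M \ ↑B ⊆ T.edgeSet \ ↑(M ∪ B) := by
      rintro e ⟨⟨heT, heM, -⟩, heB⟩
      refine ⟨heT, fun h => ?_⟩
      rcases Finset.mem_union.1 (Finset.mem_coe.1 h) with h | h
      · exact heM h
      · exact heB h
    obtain ⟨S, hS, hSX, hcmp⟩ :=
      exists_card_eq_comparable (hT.sdiff (M ∪ B).finite_toSet) hA q
    refine ⟨S, ⟨hS, hSX.trans sdiff_subset, ?_⟩, hcmp.imp ?_ fun h => h.trans sdiff_subset⟩
    · rw [Finset.disjoint_left]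
      exact fun e he h => (hSX he).2 h
    · intro h e he
      by_cases heB : e ∈ B
      · exact Finset.mem_coe.2 (Finset.mem_union_left _ heB)
      · exact Finset.mem_coe.2 (Finset.mem_union_right _ (h ⟨he, heB⟩))
  choose τ hτ hτ' using key
  exact ⟨τ, hτ, hτ'⟩

/-- As long as the component of `v₀` is infinite, every edge claimed by the frontier strategy
still belongs to the frontier. -/
theorem play_invariant [DecidableEq V] {T : SimpleGraph V} {v₀ : V} {p q : ℕ}
    (hcl : ∀ M, (cluster T v₀ M).Finite) {σ τ : Strategy V} (hσ : MakerLegal T p σ)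
    (hτ : BreakerLegal T q τ) (hfr : ∀ M B : Finset (Sym2 V),
      frontier T v₀ M ⊆ ↑(B ∪ τ M B) ∨ ↑(τ M B) ⊆ frontier T v₀ M) (n : ℕ) :
    (play σ τ (∅, ∅) n).1.card ≤ n * p ∧
      ((comp T v₀ (play σ τ (∅, ∅) n).2).Finite ∨
        (↑(play σ τ (∅, ∅) n).2 ⊆ frontier T v₀ (play σ τ (∅, ∅) n).1 ∧
          (play σ τ (∅, ∅) n).2.card = n * q)) := by
  induction n with
  | zero => simp [play]
  | succ n ih =>
    simp only [play]
    generalize (play σ τ (∅, ∅) n).1 = M at ih ⊢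
    generalize (play σ τ (∅, ∅) n).2 = B at ih ⊢
    obtain ⟨hMc, -, hMd⟩ := hσ M B
    set M' := M ∪ σ M B with hM'
    obtain ⟨hBc, -, hBd⟩ := hτ M' B
    refine ⟨?_, ?_⟩
    · have : M'.card ≤ _ := Finset.card_union_le M (σ M B)
      rw [add_mul]
      omega
    rcases ih.2 with hfin | ⟨hB, hcard⟩
    · exact Or.inl (hfin.subset (comp_anti T v₀ Finset.subset_union_left))
    rcases hfr M' B with h | h
    · exact Or.inl ((hcl M').subset (comp_subset_cluster h))
    refine Or.inr ⟨?_, ?_⟩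
    · rw [Finset.coe_union]
      refine union_subset (fun e he => ?_) h
      obtain ⟨heT, heM, v, hv, hve⟩ := hB he
      refine ⟨heT, fun heM' => ?_, v, cluster_mono T v₀ Finset.subset_union_left hv, hve⟩
      rcases Finset.mem_union.1 heM' with h' | h'
      · exact heM h'
      · exact Finset.disjoint_left.1 hMd h' (Finset.mem_union_right _ he)
    · have hdisj : Disjoint B (τ M' B) :=
        (hBd.mono_right Finset.subset_union_right).symm
      rw [Finset.card_union_of_disjoint hdisj, hcard, hBc, add_mul, one_mul]

end PercGame

/-- **Theorem (Breaker's win on the infinite `d`-regular tree, with a bound on the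
number of turns).**  Let `p, q, d` be positive integers with `d ≥ 2` and
`p(d-2) < q`, and let `T` be an infinite `d`-regular tree.  Then Breaker has a winning
strategy in the `(p,q)`-percolation game on `(T, v₀)` which guarantees that the
connected component of the root `v₀` is finite by the end of Breaker's
`⌈d / (q - p(d-2))⌉`-th turn. -/
theorem breaker_wins_on_regular_tree_in_ceil_turns (d p q : ℕ) (hd : 2 ≤ d) (hp : 1 ≤ p)
    (hq : 1 ≤ q) (hpq : p * (d - 2) < q)
    {V : Type} [DecidableEq V] (T : SimpleGraph V) [Infinite V]
    (hconn : T.Connected) (hacyc : T.IsAcyclic)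
    (hreg : ∀ v : V, (T.neighborSet v).ncard = d) (v₀ : V) :
    ∃ τ : PercGame.Strategy V, PercGame.BreakerLegal T q τ ∧
      ∀ σ : PercGame.Strategy V, PercGame.MakerLegal T p σ →
        (PercGame.comp T v₀
          (PercGame.play σ τ (∅, ∅)
            ((d + (q - p * (d - 2)) - 1) / (q - p * (d - 2)))).2).Finite := by
  obtain ⟨τ, hτ, hfr⟩ :=
    PercGame.exists_frontier_strategy (PercGame.edgeSet_infinite hd hreg) v₀ q
  refine ⟨τ, hτ, fun σ hσ => ?_⟩
  set N := (d + (q - p * (d - 2)) - 1) / (q - p * (d - 2)) with hN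
  obtain ⟨hM, hfin | ⟨hB, hcard⟩⟩ := PercGame.play_invariant
    (fun M => (PercGame.frontier_ncard_le hd hreg v₀ M).1) hσ hτ hfr N
  · exact hfin
  obtain ⟨hclfin, hfrfin, hle⟩ :=
    PercGame.frontier_ncard_le hd hreg v₀ (PercGame.play σ τ (∅, ∅) N).1
  refine hclfin.subset (PercGame.comp_subset_cluster ?_)
  refine (Set.eq_of_subset_of_ncard_le hB ?_ hfrfin).ge
  rw [Set.ncard_coe_finset, hcard]
  have hdN : d ≤ N * (q - p * (d - 2)) := by
    have h := Nat.lt_div_mul_add (a := d + (q - p * (d - 2)) - 1) (b := q - p * (d - 2))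
      (by omega)
    rw [← hN] at h
    omega
  calc _ ≤ _ := hle
    _ ≤ N * (q - p * (d - 2)) + N * p * (d - 2) := by gcongr
    _ = N * q := by rw [mul_assoc, ← mul_add, Nat.sub_add_cancel hpq.le]
end

section
/- Let p, q, a, b be positive integers with 2 ≤ a ≤ b and p(b−2) − ⌈p/a⌉(b−a) < q. Then Breaker has a winning strategy in the (p,q)-percolation game on the infinite bi-regular tree T_{a,b} even if, before the game begins, Maker is allowed to pre-emptively mark an arbitrary finite set of edges of T_{a,b} as safe. -/
/-- A locally finite rooted tree, presented by its parent map (which fixes the root). -/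
structure ParentTree (V : Type) where
  root : V
  par : V → V
  ch : V → Finset V
  par_root : par root = root
  mem_ch : ∀ v w, w ∈ ch v ↔ w ≠ root ∧ par w = v
  exists_iterate : ∀ v, ∃ i, par^[i] v = root

namespace ParentTree

open Finset

variable {V : Type} (R : ParentTree V)

lemma iterate_root (i : ℕ) : R.par^[i] R.root = R.root :=
  Function.iterate_fixed R.par_root i

variable [DecidableEq V]

/- Edges are identified with their endpoints away from the root. -/

open Classical in
/-- The vertices joined to the root by edges in `N`. -/
noncomputable def cluster (N : Finset V) : Finset V :=
  (insert R.root N).filter fun v => ∀ i, R.par^[i] v ∈ insert R.root N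

/-- The edges whose upper endpoint lies in the cluster. -/
noncomputable def below (N : Finset V) : Finset V := (R.cluster N).biUnion R.ch

/-- The unclaimed edges leaving the cluster. -/
noncomputable def boundary (N B : Finset V) : Finset V := R.below N \ (N ∪ B)

open Classical in
/-- The boundary edges lying above some safe edge that Breaker has not yet cut off. -/
noncomputable def strays (N B : Finset V) : Finset V :=
  (R.boundary N B).filter fun f =>
    ∃ e ∈ N, (∀ i, R.par^[i] e ∉ B) ∧ ∃ i, R.par^[i] e = f

open Classical in
/-- The boundary edges whose upper endpoint lies in `S`. -/
noncomputable def boundaryAt (S : Set V) (N B : Finset V) : Finset V :=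
  (R.boundary N B).filter fun f => R.par f ∈ S

variable {R} {N N' B D X : Finset V} {S : Set V} {v w : V}

lemma mem_cluster_iff_forall : v ∈ R.cluster N ↔ ∀ i, R.par^[i] v ∈ insert R.root N := by
  classical
  simp only [cluster, mem_filter, and_iff_right_iff_imp]
  exact fun h => h 0

lemma root_mem_cluster : R.root ∈ R.cluster N := by
  simp [mem_cluster_iff_forall, iterate_root]

lemma mem_cluster_iff : v ∈ R.cluster N ↔ v ∈ insert R.root N ∧ R.par v ∈ R.cluster N := by
  simp only [mem_cluster_iff_forall]
  refine ⟨fun h => ⟨h 0, fun i => h (i + 1)⟩, fun h i => ?_⟩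
  cases i with
  | zero => exact h.1
  | succ i => exact h.2 i

lemma cluster_subset : R.cluster N ⊆ insert R.root N := fun _ h => (mem_cluster_iff.1 h).1

lemma iterate_mem_cluster (h : v ∈ R.cluster N) (i : ℕ) : R.par^[i] v ∈ R.cluster N := by
  induction i generalizing v with
  | zero => exact h
  | succ i ih => exact ih (mem_cluster_iff.1 h).2

lemma cluster_mono (h : N ⊆ N') : R.cluster N ⊆ R.cluster N' := fun v hv => by
  rw [mem_cluster_iff_forall] at hv ⊢
  exact fun i => insert_subset_insert _ h (hv i)

lemma mem_below : w ∈ R.below N ↔ w ≠ R.root ∧ R.par w ∈ R.cluster N := by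
  simp only [below, mem_biUnion, R.mem_ch]
  constructor
  · rintro ⟨v, hv, hw, rfl⟩
    exact ⟨hw, hv⟩
  · exact fun h => ⟨_, h.2, h.1, rfl⟩

lemma below_mono (h : N ⊆ N') : R.below N ⊆ R.below N' := fun w hw => by
  rw [mem_below] at hw ⊢
  exact ⟨hw.1, cluster_mono h hw.2⟩

lemma mem_boundary :
    w ∈ R.boundary N B ↔ w ≠ R.root ∧ R.par w ∈ R.cluster N ∧ w ∉ N ∧ w ∉ B := by
  simp only [boundary, mem_sdiff, mem_below, mem_union, not_or, and_assoc]

lemma boundary_union : R.boundary N (B ∪ D) = R.boundary N B \ D := by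
  ext w
  simp only [mem_boundary, mem_sdiff, mem_union, not_or]
  tauto

lemma boundaryAt_union : R.boundaryAt S N (B ∪ D) = R.boundaryAt S N B \ D := by
  ext w
  simp only [boundaryAt, boundary_union, mem_filter, mem_sdiff]
  tauto

lemma mem_strays : w ∈ R.strays N B ↔ w ∈ R.boundary N B ∧
    ∃ e ∈ N, (∀ i, R.par^[i] e ∉ B) ∧ ∃ i, R.par^[i] e = w := by
  classical
  simp [strays]

/-- The first edge outside the cluster on the way from the root to `v`. -/
lemma exists_iterate_leaving (h : v ∉ R.cluster N) :
    ∃ i, R.par^[i] v ∉ insert R.root N ∧ R.par (R.par^[i] v) ∈ R.cluster N := by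
  obtain ⟨n, hn⟩ := R.exists_iterate v
  induction n generalizing v with
  | zero => exact absurd (by rw [show v = R.root from hn]; exact root_mem_cluster) h
  | succ n ih =>
    by_cases hp : R.par v ∈ R.cluster N
    · exact ⟨0, fun hv => h (mem_cluster_iff.2 ⟨hv, hp⟩), hp⟩
    · obtain ⟨i, hi⟩ := ih hp hn
      exact ⟨i + 1, hi⟩

/-- Double counting of the edges hanging below the cluster, restricted by a condition on their
upper endpoint. -/
lemma card_boundary_filter (P : V → Prop) [DecidablePred P] (hNB : Disjoint N B)
    (hB : B ⊆ R.below N) :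
    ((R.boundary N B).filter fun w => P (R.par w)).card
      + (((R.cluster N).erase R.root).filter fun w => P (R.par w)).card
      + (B.filter fun w => P (R.par w)).card = ∑ v ∈ (R.cluster N).filter P, (R.ch v).card := by
  rw [← card_biUnion]
  · rw [← card_union_of_disjoint, ← card_union_of_disjoint]
    · congr 1
      ext w
      simp only [mem_union, mem_filter, mem_boundary, mem_erase, mem_biUnion, R.mem_ch]
      constructor
      · rintro ((⟨⟨h1, h2, -⟩, h3⟩ | ⟨⟨h1, h2⟩, h3⟩) | ⟨h1, h2⟩)
        · exact ⟨_, ⟨h2, h3⟩, h1, rfl⟩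
        · exact ⟨_, ⟨(mem_cluster_iff.1 h2).2, h3⟩, h1, rfl⟩
        · have := mem_below.1 (hB h1)
          exact ⟨_, ⟨this.2, h2⟩, this.1, rfl⟩
      · rintro ⟨v, ⟨h1, h2⟩, h3, rfl⟩
        by_cases hwB : w ∈ B
        · exact .inr ⟨hwB, h2⟩
        by_cases hwN : w ∈ N
        · exact .inl (.inr ⟨⟨h3, mem_cluster_iff.2 ⟨mem_insert_of_mem hwN, h1⟩⟩, h2⟩)
        · exact .inl (.inl ⟨⟨h3, h1, hwN, hwB⟩, h2⟩)
    · rw [disjoint_left]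
      intro w hw hwB
      have hwB := (mem_filter.1 hwB).1
      simp only [mem_union, mem_filter, mem_boundary, mem_erase] at hw
      rcases hw with hw | hw
      · exact hw.1.2.2.2 hwB
      · exact disjoint_left.1 hNB
          (mem_of_mem_insert_of_ne (cluster_subset hw.1.2) hw.1.1) hwB
    · rw [disjoint_left]
      intro w hw hwC
      simp only [mem_filter, mem_boundary, mem_erase] at hw hwC
      exact hw.1.2.2.1 (mem_of_mem_insert_of_ne (cluster_subset hwC.1.2) hwC.1.1)
  · intro v _ v' _ hne
    rw [Function.onFun, disjoint_left]
    intro w hw hw'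
    rw [R.mem_ch] at hw hw'
    exact hne (hw.2.symm.trans hw'.2)

variable (R) in
/-- Vertices in `S` have degree `a`, the others have degree `b`, and all edges run between `S` and
its complement. -/
structure IsBiregular (S : Set V) (a b : ℕ) : Prop where
  par_mem : ∀ v, v ≠ R.root → (R.par v ∈ S ↔ v ∉ S)
  card_root : (R.root ∈ S → (R.ch R.root).card = a) ∧ (R.root ∉ S → (R.ch R.root).card = b)
  card_of_mem : ∀ v ∈ S, v ≠ R.root → (R.ch v).card + 1 = a
  card_of_notMem : ∀ v ∉ S, v ≠ R.root → (R.ch v).card + 1 = b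

lemma sum_card_ch_add_card_erase (s : Finset V) (d : ℕ)
    (h : ∀ v ∈ s, (R.ch v).card + (if v = R.root then 0 else 1) = d) :
    ∑ v ∈ s, (R.ch v).card + (s.erase R.root).card = d * s.card := by
  rw [← filter_ne', card_filter, ← sum_add_distrib, mul_comm, ← smul_eq_mul, ← sum_const]
  refine sum_congr rfl fun v hv => ?_
  rw [← h v hv]
  by_cases hv : v = R.root <;> simp [hv]

variable {a b p q : ℕ}

open Classical in
lemma IsBiregular.card_boundary (hR : R.IsBiregular S a b) (hNB : Disjoint N B)
    (hB : B ⊆ R.below N) :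
    (R.boundary N B).card + B.card + 2 * ((R.cluster N).card - 1) =
        a * ((R.cluster N).filter (· ∈ S)).card + b * ((R.cluster N).filter (· ∉ S)).card ∧
      (R.boundaryAt S N B).card + (B.filter (R.par · ∈ S)).card + ((R.cluster N).card - 1) =
        a * ((R.cluster N).filter (· ∈ S)).card := by
  have h1 := card_boundary_filter (R := R) (fun _ => True) hNB hB
  have h2 := card_boundary_filter (R := R) (· ∈ S) hNB hB
  simp only [filter_true] at h1
  have h3 := sum_card_ch_add_card_erase (R := R) ((R.cluster N).filter (· ∈ S)) a fun v hv => by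
    have hv := (mem_filter.1 hv).2
    split_ifs with h
    · rw [h, hR.card_root.1 (h ▸ hv)]; rfl
    · exact hR.card_of_mem v hv h
  have h4 := sum_card_ch_add_card_erase (R := R) ((R.cluster N).filter (· ∉ S)) b fun v hv => by
    have hv := (mem_filter.1 hv).2
    split_ifs with h
    · rw [h, hR.card_root.2 (h ▸ hv)]; rfl
    · exact hR.card_of_notMem v hv h
  have h5 := sum_filter_add_sum_filter_not (R.cluster N) (· ∈ S) fun v => (R.ch v).card
  have h6 : ((R.cluster N).erase R.root).filter (fun w => R.par w ∈ S)
      = ((R.cluster N).filter (· ∉ S)).erase R.root := by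
    ext w
    simp only [mem_filter, mem_erase]
    constructor
    · rintro ⟨⟨h, h'⟩, h''⟩
      exact ⟨h, h', (hR.par_mem w h).1 h''⟩
    · rintro ⟨h, h', h''⟩
      exact ⟨⟨h, h'⟩, (hR.par_mem w h).2 h''⟩
  have h7 := card_filter_add_card_filter_not (s := (R.cluster N).erase R.root) (· ∈ S)
  rw [filter_erase, filter_erase] at h7
  have h8 := card_erase_of_mem (root_mem_cluster (R := R) (N := N))
  rw [h6] at h2
  simp only [boundaryAt]
  constructor <;> omega

variable (R) in
/-- The requirement on Breaker's reply `D` in the position `(N, B)`: he cuts the whole boundary if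
he can; otherwise he plays on the boundary only, first cutting off stray safe edges and then giving
priority to edges whose upper endpoint is in `S`. -/
structure IsGoodReply (S : Set V) (q : ℕ) (N B D : Finset V) : Prop where
  card_eq : D.card = q
  disjoint : Disjoint D (N ∪ B)
  root_notMem : R.root ∉ D
  subset : R.boundary N B ⊆ D ∨ D ⊆ R.boundary N B ∧ ((R.strays N B).card ≤ q →
    R.strays N B ⊆ D ∧ (R.boundaryAt S N B ⊆ D ∨ D ⊆ R.strays N B ∪ R.boundaryAt S N B))

lemma strays_subset : R.strays N B ⊆ R.boundary N B := by
  classical exact filter_subset _ _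

lemma boundaryAt_subset : R.boundaryAt S N B ⊆ R.boundary N B := by
  classical exact filter_subset _ _

lemma disjoint_boundary : Disjoint (R.boundary N B) (N ∪ B) := sdiff_disjoint

lemma root_notMem_boundary : R.root ∉ R.boundary N B := fun h => (mem_boundary.1 h).1 rfl

variable (R S q N B) in
lemma exists_isGoodReply [Infinite V] : ∃ D, R.IsGoodReply S q N B D := by
  rcases le_or_gt (R.boundary N B).card q with h | h
  · obtain ⟨t, ht, htq⟩ : ∃ t ⊇ R.boundary N B ∪ (N ∪ B ∪ {R.root}),
        t.card = q + (N ∪ B ∪ {R.root}).card :=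
      Infinite.exists_superset_card_eq _ _ ((card_union_le _ _).trans (by omega))
    have hd : Disjoint (R.boundary N B) (N ∪ B ∪ {R.root}) := by
      rw [disjoint_union_right]
      exact ⟨disjoint_boundary, disjoint_singleton_right.2 root_notMem_boundary⟩
    refine ⟨t \ (N ∪ B ∪ {R.root}), ?_, ?_, by simp, .inl ?_⟩
    · rw [card_sdiff_of_subset (subset_union_right.trans ht)]
      omega
    · exact sdiff_disjoint.mono_right subset_union_left
    · exact fun w hw => mem_sdiff.2 ⟨ht (mem_union_left _ hw), disjoint_left.1 hd hw⟩
  suffices H : ∃ D ⊆ R.boundary N B, D.card = q ∧ ((R.strays N B).card ≤ q →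
      R.strays N B ⊆ D ∧ (R.boundaryAt S N B ⊆ D ∨ D ⊆ R.strays N B ∪ R.boundaryAt S N B)) by
    obtain ⟨D, hD, hc, hr⟩ := H
    exact ⟨D, hc, disjoint_boundary.mono_left hD, fun hr => root_notMem_boundary (hD hr),
      .inr ⟨hD, hr⟩⟩
  by_cases hs : (R.strays N B).card ≤ q
  · rcases le_total (R.strays N B ∪ R.boundaryAt S N B).card q with hu | hu
    · obtain ⟨D, h1, h2, h3⟩ := exists_subsuperset_card_eq
        (union_subset strays_subset boundaryAt_subset) hu h.le
      exact ⟨D, h2, h3, fun _ => ⟨subset_union_left.trans h1, .inl (subset_union_right.trans h1)⟩⟩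
    · obtain ⟨D, h1, h2, h3⟩ := exists_subsuperset_card_eq
        (subset_union_left (s₁ := R.strays N B) (s₂ := R.boundaryAt S N B)) hs hu
      exact ⟨D, h2.trans (union_subset strays_subset boundaryAt_subset), h3,
        fun _ => ⟨h1, .inr h2⟩⟩
  · obtain ⟨D, h1, h2⟩ := exists_subset_card_eq h.le
    exact ⟨D, h1, h2, fun h => absurd h hs⟩

/-- No safe edge outside the cluster is still connected to the root. -/
def NoStrays (R : ParentTree V) (N B : Finset V) : Prop :=
  ∀ e ∈ N, e ∉ R.cluster N → ∃ i, R.par^[i] e ∈ B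

lemma cluster_union_sdiff_subset (h : R.NoStrays N B) (hB : Disjoint (N ∪ X) B)
    (hr : R.root ∉ B) : R.cluster (N ∪ X) \ R.cluster N ⊆ X ∩ R.cluster (N ∪ X) := by
  intro v hv
  obtain ⟨hv, hv'⟩ := mem_sdiff.1 hv
  refine mem_inter.2 ⟨?_, hv⟩
  have h1 := cluster_subset hv
  rw [mem_insert, mem_union] at h1
  rcases h1 with rfl | h1 | h1
  · exact absurd root_mem_cluster hv'
  · obtain ⟨i, hi⟩ := h v h1 hv'
    rcases mem_insert.1 (cluster_subset (iterate_mem_cluster hv i)) with h2 | h2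
    · exact absurd (h2 ▸ hi) hr
    · exact absurd hi (disjoint_left.1 hB h2)
  · exact h1

lemma iterate_unique_of_mem_boundary {e f f' : V} (hf : f ∈ R.boundary N B)
    (hf' : f' ∈ R.boundary N B) (h : ∃ i, R.par^[i] e = f) (h' : ∃ i, R.par^[i] e = f') :
    f = f' := by
  obtain ⟨i, rfl⟩ := h
  obtain ⟨j, rfl⟩ := h'
  wlog hij : i < j generalizing i j
  · rcases (not_lt.1 hij).eq_or_lt with rfl | hij
    · rfl
    · exact (this j hf' i hf hij).symm
  obtain ⟨k, rfl⟩ := Nat.exists_eq_add_of_lt hij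
  have h1 := iterate_mem_cluster (mem_boundary.1 hf).2.1 k
  rw [← Function.iterate_succ_apply' R.par, ← Function.iterate_add_apply,
    show k + i.succ = i + k + 1 by omega] at h1
  rcases mem_insert.1 (cluster_subset h1) with h2 | h2
  · exact absurd h2 (mem_boundary.1 hf').1
  · exact absurd h2 (mem_boundary.1 hf').2.2.1

lemma card_strays_union_le (h : R.NoStrays N B) :
    (R.strays (N ∪ X) B).card ≤ (X \ R.cluster (N ∪ X)).card := by
  have key : ∀ f ∈ R.strays (N ∪ X) B, ∃ e ∈ X \ R.cluster (N ∪ X), ∃ i, R.par^[i] e = f := by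
    intro f hf
    obtain ⟨hf, e, he, heB, i, hi⟩ := mem_strays.1 hf
    have hec : e ∉ R.cluster (N ∪ X) := fun hec => by
      have := cluster_subset (iterate_mem_cluster hec i)
      rw [hi] at this
      rcases mem_insert.1 this with h2 | h2
      · exact (mem_boundary.1 hf).1 h2
      · exact (mem_boundary.1 hf).2.2.1 h2
    refine ⟨e, mem_sdiff.2 ⟨?_, hec⟩, i, hi⟩
    rcases mem_union.1 he with he | he
    · obtain ⟨j, hj⟩ := h e he fun h' => hec (cluster_mono subset_union_left h')
      exact absurd hj (heB j)
    · exact he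
  choose! g hg hg' using key
  refine card_le_card_of_injOn g hg fun f hf f' hf' hff' => ?_
  exact iterate_unique_of_mem_boundary (strays_subset hf) (strays_subset hf') (hg' f hf)
    (hff' ▸ hg' f' hf')

lemma NoStrays.of_strays_subset (h : R.strays N B ⊆ D) : R.NoStrays N (B ∪ D) := by
  intro e he hec
  by_contra! hcon
  obtain ⟨i, hi, hi'⟩ := exists_iterate_leaving hec
  have hi := not_or.1 (mem_insert.not.1 hi)
  refine hcon i (mem_union_right _ (h (mem_strays.2 ⟨mem_boundary.2 ⟨hi.1, hi', hi.2, ?_⟩,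
    e, he, ?_, i, rfl⟩)))
  · exact fun h' => hcon i (mem_union_left _ h')
  · exact fun j h' => hcon j (mem_union_left _ h')

/-- One round of the game decreases the potential `n + (b - a) * g`, where `n` is the number of
boundary edges, `y` the number of those with upper endpoint in `S`, and `y ≤ a * g`. In this round
the cluster gains `k` vertices in `S` and `j` others, and there are `s` stray boundary edges. -/
lemma exists_potential_lt {a b p q c n n' y y' k j s g : ℤ} (ha : 2 ≤ a) (hab : a ≤ b)
    (hc : c * a ≤ p + a - 1) (hpq : p * (b - 2) - c * (b - a) < q) (hcq : c * a ≤ p + q)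
    (hs : 0 ≤ s) (hkjs : k + j + s ≤ p)
    (hn : n' = n + (a - 2) * k + (b - 2) * j - q) (hy : 0 ≤ y + (a - 1) * k - j)
    (hyg : y ≤ a * g)
    (hy' : y' = 0 ∨ y' ≤ y + (a - 1) * k - j - (q - s)) :
    ∃ g', 0 ≤ g' ∧ y' ≤ a * g' ∧ n' + (b - a) * g' < n + (b - a) * g := by
  obtain ⟨d, hd⟩ : ∃ d, d = p - k - j := ⟨_, rfl⟩
  obtain rfl : j = p - k - d := by omega
  have hd0 : 0 ≤ d := by omega
  have hdab : d * (b - a) ≤ d * (b - 2) := by gcongr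
  rcases le_or_gt y' 0 with hy0 | hy0
  · refine ⟨0, le_rfl, by omega, ?_⟩
    have h1 : c ≤ g + k + d := by
      by_contra! h
      have : (g + k + d + 1) * a ≤ c * a := by gcongr; omega
      nlinarith
    have h2 : (c - k - g) * (b - a) ≤ d * (b - a) := by
      gcongr
      all_goals omega
    linarith
  · have h1 : y' ≤ a * (g + k - c + d) := by
      have : 2 * d ≤ a * d := by gcongr
      rcases hy' with h | h <;> linarith
    refine ⟨g + k - c + d, ?_, h1, by linarith⟩
    by_contra! h
    nlinarith

/-- If Maker's safe edges are all cut off or joined to the root before her turn, then the potential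
decreases during the round. -/
lemma IsBiregular.exists_potential_lt (hR : R.IsBiregular S a b) {c g : ℤ} (ha : 2 ≤ a)
    (hab : a ≤ b) (hc : c * a ≤ p + a - 1) (hpq : (p : ℤ) * (b - 2) - c * (b - a) < q)
    (hcq : c * a ≤ p + q) (hle : p ≤ q) (hNB : Disjoint N B) (hB : B ⊆ R.below N)
    (hstray : R.NoStrays N B) (hX : X.card ≤ p) (hXB : Disjoint X B)
    (hD : R.IsGoodReply S q (N ∪ X) B D) (hne : (R.boundary (N ∪ X) (B ∪ D)).Nonempty)
    (hyg : (R.boundaryAt S N B).card ≤ a * g) :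
    R.NoStrays (N ∪ X) (B ∪ D) ∧ ∃ g' : ℤ, 0 ≤ g' ∧
      (R.boundaryAt S (N ∪ X) (B ∪ D)).card ≤ a * g' ∧
      (R.boundary (N ∪ X) (B ∪ D)).card + (b - a) * g' < (R.boundary N B).card + (b - a) * g := by
  classical
  have hNXB : Disjoint (N ∪ X) B := disjoint_union_left.2 ⟨hNB, hXB⟩
  have hr : R.root ∉ B := fun h => (mem_below.1 (hB h)).1 rfl
  have hgrow := card_le_card (cluster_union_sdiff_subset hstray hNXB hr)
  have hsplit := card_inter_add_card_sdiff X (R.cluster (N ∪ X))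
  have hscard := card_strays_union_le (X := X) hstray
  obtain ⟨hDsub, hD'⟩ : D ⊆ R.boundary (N ∪ X) B ∧ _ := hD.subset.resolve_left fun h => by
    rw [boundary_union, sdiff_eq_empty_iff_subset.2 h] at hne
    exact not_nonempty_empty hne
  obtain ⟨hsD, hyD⟩ := hD' (by omega)
  refine ⟨.of_strays_subset hsD, ?_⟩
  obtain ⟨h1, h2⟩ := hR.card_boundary hNB hB
  obtain ⟨h3, h4⟩ := hR.card_boundary hNXB (hB.trans (below_mono subset_union_left))
  have hsub : R.cluster N ⊆ R.cluster (N ∪ X) := cluster_mono subset_union_left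
  have h5 := card_sdiff_add_card_eq_card hsub
  have h6 := card_filter_add_card_filter_not (s := R.cluster N) (· ∈ S)
  have h7 := card_filter_add_card_filter_not (s := R.cluster (N ∪ X)) (· ∈ S)
  have h8 := card_pos.2 ⟨_, root_mem_cluster (R := R) (N := N)⟩
  have h9 : (R.boundary (N ∪ X) (B ∪ D)).card + q = (R.boundary (N ∪ X) B).card := by
    rw [boundary_union, ← hD.card_eq, card_sdiff_add_card_eq_card hDsub]
  have h10 : (R.boundaryAt S (N ∪ X) (B ∪ D)).card = 0 ∨
      (R.boundaryAt S (N ∪ X) (B ∪ D)).card + q ≤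
        (R.boundaryAt S (N ∪ X) B).card + (R.strays (N ∪ X) B).card := by
    rw [boundaryAt_union]
    refine hyD.imp (fun h => by rw [sdiff_eq_empty_iff_subset.2 h, card_empty]) fun h => ?_
    have i1 := card_sdiff_add_card_inter (R.boundaryAt S (N ∪ X) B) D
    have i2 : D ⊆ R.strays (N ∪ X) B ∪ (R.boundaryAt S (N ∪ X) B ∩ D) := fun w hw => by
      have := h hw
      simp only [mem_union, mem_inter] at this ⊢
      tauto
    have i3 := (card_le_card i2).trans (card_union_le _ _)
    rw [hD.card_eq] at i3
    omega
  generalize ((R.cluster N).filter (· ∈ S)).card = u at *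
  generalize ((R.cluster N).filter (· ∉ S)).card = v at *
  generalize ((R.cluster (N ∪ X)).filter (· ∈ S)).card = u' at *
  generalize ((R.cluster (N ∪ X)).filter (· ∉ S)).card = v' at *
  zify at *
  rw [Nat.cast_sub (by omega)] at h1 h2 h3 h4
  push_cast at h1 h2 h3 h4
  refine ParentTree.exists_potential_lt (c := c) (p := p) (q := q) (k := u' - u) (j := v' - v)
    (s := (R.strays (N ∪ X) B).card) (y := (R.boundaryAt S N B).card) (n := (R.boundary N B).card)
    (by exact_mod_cast ha) (by exact_mod_cast hab) hc hpq hcq (by positivity) (by omega)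
    (by linarith) ?_ hyg (h10.imp id fun h => ?_)
  · have : (0 : ℤ) ≤ (R.boundaryAt S (N ∪ X) B).card := by positivity
    linarith
  · linarith

/-- A play of the game in which Breaker always gives a good reply. -/
structure IsPlay (R : ParentTree V) (S : Set V) (p q : ℕ) (N B X D : ℕ → Finset V) : Prop where
  mem_cluster : ∀ v ∈ N 0, v ∈ R.cluster (N 0)
  B_zero : B 0 = ∅
  N_succ : ∀ t, N (t + 1) = N t ∪ X t
  B_succ : ∀ t, B (t + 1) = B t ∪ D t
  card_X : ∀ t, (X t).card ≤ p
  disjoint_X : ∀ t, Disjoint (X t) (B t)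
  isGoodReply : ∀ t, R.IsGoodReply S q (N (t + 1)) (B t) (D t)

namespace IsPlay

variable {N B X D : ℕ → Finset V}

lemma reply_subset (h : R.IsPlay S p q N B X D) {t : ℕ}
    (hne : (R.boundary (N (t + 1)) (B (t + 1))).Nonempty) :
    D t ⊆ R.boundary (N (t + 1)) (B t) := by
  refine ((h.isGoodReply t).subset.resolve_left fun h' => ?_).1
  rw [h.B_succ, boundary_union, sdiff_eq_empty_iff_subset.2 h'] at hne
  exact not_nonempty_empty hne

lemma invariant (h : R.IsPlay S p q N B X D) (hne : ∀ t, (R.boundary (N t) (B t)).Nonempty)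
    (t : ℕ) : Disjoint (N t) (B t) ∧ B t ⊆ R.below (N t) ∧ (B t).card = q * t ∧
      (N t).card ≤ (N 0).card + p * t := by
  induction t with
  | zero => simp [h.B_zero]
  | succ t ih =>
    obtain ⟨h1, h2, h3, h4⟩ := ih
    have hD := h.isGoodReply t
    have hdisj := disjoint_union_right.1 hD.disjoint
    refine ⟨?_, ?_, ?_, ?_⟩
    · rw [h.B_succ, disjoint_union_right]
      refine ⟨?_, hdisj.1.symm⟩
      rw [h.N_succ, disjoint_union_left]
      exact ⟨h1, h.disjoint_X t⟩
    · rw [h.B_succ]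
      refine union_subset (h2.trans (below_mono ?_))
        ((h.reply_subset (hne _)).trans sdiff_subset)
      rw [h.N_succ]
      exact subset_union_left
    · rw [h.B_succ, card_union_of_disjoint hdisj.2.symm, h3, hD.card_eq, mul_add_one]
    · rw [h.N_succ, mul_add_one]
      have := card_union_le (N t) (X t)
      have := h.card_X t
      omega

/-- If all vertices in `S` have degree two and `p * (b - 2) < 2 * q`, then any play on the boundary
wins for Breaker. -/
lemma exists_boundary_eq_empty_of_two (hR : R.IsBiregular S 2 b) (hpq : (p : ℤ) * (b - 2) < 2 * q)
    (hb : 2 ≤ b) (h : R.IsPlay S p q N B X D) : ∃ t, R.boundary (N t) (B t) = ∅ := by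
  classical
  by_contra! hne
  obtain ⟨T, hT⟩ : ∃ T : ℕ, ((b : ℤ) - 2) * (2 + (N 0).card) + 4 < T := by
    obtain ⟨T, hT⟩ := exists_nat_gt (((b : ℤ) - 2) * (2 + (N 0).card) + 4)
    exact ⟨T, by exact_mod_cast hT⟩
  obtain ⟨h1, h2, h3, h4⟩ := h.invariant hne T
  obtain ⟨h5, h6⟩ := hR.card_boundary h1 h2
  have h7 := card_filter_add_card_filter_not (s := R.cluster (N T)) (· ∈ S)
  have h8 := card_pos.2 ⟨_, root_mem_cluster (R := R) (N := N T)⟩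
  have h9 := (card_le_card (cluster_subset (R := R) (N := N T))).trans (card_insert_le _ _)
  generalize ((R.cluster (N T)).filter (· ∈ S)).card = u at *
  generalize ((R.cluster (N T)).filter (· ∉ S)).card = v at *
  have h10 : 2 * v ≤ 2 + (N 0).card + p * T := by omega
  have h11 : ((R.boundary (N T) (B T)).card : ℤ) + q * T = (b - 2) * v + 2 := by
    rw [h3] at h5
    zify at *
    rw [Nat.cast_sub (by omega)] at h5
    push_cast at h5
    linarith
  zify at h10
  have h12 : ((b : ℤ) - 2) * (2 * v) ≤ (b - 2) * (2 + (N 0).card + p * T) :=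
    mul_le_mul_of_nonneg_left h10 (by omega)
  have h13 : ((p : ℤ) * (b - 2) + 1) * T ≤ 2 * q * T :=
    mul_le_mul_of_nonneg_right (by omega) (by positivity)
  have h14 : (0 : ℤ) ≤ (R.boundary (N T) (B T)).card := by positivity
  linarith

/-- If Breaker has enough moves to cut off all stray edges, then the potential argument applies. -/
lemma exists_boundary_eq_empty_of_le (hR : R.IsBiregular S a b) {c : ℤ} (ha : 2 ≤ a)
    (hab : a ≤ b) (hc : c * a ≤ p + a - 1) (hpq : (p : ℤ) * (b - 2) - c * (b - a) < q)
    (hcq : c * a ≤ p + q) (hle : p ≤ q) (h : R.IsPlay S p q N B X D) :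
    ∃ t, R.boundary (N t) (B t) = ∅ := by
  by_contra! hne
  obtain ⟨K, hK⟩ : ∃ K : ℤ, K = (R.boundary (N 0) (B 0)).card +
    (b - a) * ((R.boundaryAt S (N 0) (B 0)).card : ℤ) := ⟨_, rfl⟩
  have key : ∀ t : ℕ, R.NoStrays (N t) (B t) ∧ ∃ g : ℤ, 0 ≤ g ∧
      (R.boundaryAt S (N t) (B t)).card ≤ a * g ∧
      (R.boundary (N t) (B t)).card + (b - a) * g + t ≤ K := by
    intro t
    induction t with
    | zero =>
      refine ⟨fun e he he' => absurd (h.mem_cluster e he) he',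
        (R.boundaryAt S (N 0) (B 0)).card, Nat.cast_nonneg _, ?_, by simp [hK]⟩
      exact_mod_cast Nat.le_mul_of_pos_left _ (by omega)
    | succ t ih =>
      obtain ⟨hs, g, -, hyg, hgK⟩ := ih
      obtain ⟨h1, h2, -, -⟩ := h.invariant hne t
      have hD := h.isGoodReply t
      have hne' := hne (t + 1)
      rw [h.N_succ] at hD hne'
      rw [h.B_succ] at hne'
      obtain ⟨hs', g', hg', hyg', hlt⟩ := hR.exists_potential_lt ha hab hc hpq hcq hle h1 h2 hs
        (h.card_X t) (h.disjoint_X t) hD hne' hyg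
      rw [h.N_succ, h.B_succ]
      exact ⟨hs', g', hg', hyg', by push_cast; omega⟩
  obtain ⟨-, g, hg, -, hgK⟩ := key (K.toNat + 1)
  have h1 : 0 ≤ ((b : ℤ) - a) * g := mul_nonneg (by omega) hg
  omega

lemma exists_boundary_eq_empty (hR : R.IsBiregular S a b) (ha : 2 ≤ a) (hab : a ≤ b) (hp : 1 ≤ p)
    (hpq : (p : ℤ) * ((b : ℤ) - 2) - (((p + a - 1) / a : ℕ) : ℤ) * ((b : ℤ) - (a : ℤ)) < (q : ℤ))
    (h : R.IsPlay S p q N B X D) : ∃ t, R.boundary (N t) (B t) = ∅ := by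
  have hc : (p + a - 1) / a * a ≤ p + a - 1 := Nat.div_mul_le_self _ _
  have hcp : (p + a - 1) / a ≤ p := by
    rw [Nat.div_le_iff_le_mul (by omega)]
    have := Nat.le_mul_of_pos_right p (by omega : 0 < a)
    omega
  generalize (p + a - 1) / a = c at *
  have hc' : (c : ℤ) * a ≤ p + a - 1 := by
    zify at hc
    rw [Nat.cast_sub (by omega)] at hc
    exact_mod_cast hc
  have hq : (p : ℤ) * (a - 2) + 1 ≤ q := by
    have : (0 : ℤ) ≤ (p - c) * (b - a) := mul_nonneg (by omega) (by omega)
    linarith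
  by_cases h2 : a = 2 ∧ b ≤ 3
  · obtain ⟨rfl, hb⟩ := h2
    refine exists_boundary_eq_empty_of_two hR ?_ hab h
    obtain rfl | rfl : b = 2 ∨ b = 3 := by omega
    all_goals push_cast at *; omega
  · refine exists_boundary_eq_empty_of_le hR ha hab hc' hpq ?_ ?_ h
    · have : 1 * ((a : ℤ) - 2) ≤ p * (a - 2) :=
        mul_le_mul_of_nonneg_right (by omega) (by omega)
      linarith
    · zify
      by_cases ha2 : a = 2
      · subst ha2
        have : ((p : ℤ) - c) * 2 ≤ (p - c) * (b - 2) :=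
          mul_le_mul_of_nonneg_left (by omega) (by omega)
        push_cast at *
        linarith
      · have : (p : ℤ) * 1 ≤ p * (a - 2) := mul_le_mul_of_nonneg_left (by omega) (by omega)
        omega

end IsPlay

variable (R) in
lemma exists_superset_subset_cluster (A : Finset V) : ∃ N, A ⊆ N ∧ N ⊆ R.cluster N := by
  induction A using Finset.induction with
  | empty => exact ⟨∅, by simp⟩
  | insert v A _ ih =>
    obtain ⟨N, hAN, hN⟩ := ih
    obtain ⟨n, hn⟩ := R.exists_iterate v
    refine ⟨N ∪ (range (n + 1)).image fun j => R.par^[j] v, ?_, ?_⟩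
    · refine insert_subset (mem_union_right _ (mem_image.2 ⟨0, by simp, rfl⟩))
        (hAN.trans subset_union_left)
    · refine union_subset (hN.trans (cluster_mono subset_union_left)) fun w hw => ?_
      obtain ⟨j, -, rfl⟩ := mem_image.1 hw
      rw [mem_cluster_iff_forall]
      intro i
      rw [← Function.iterate_add_apply]
      by_cases hij : i + j ≤ n
      · exact mem_insert_of_mem (mem_union_right _
          (mem_image.2 ⟨i + j, mem_range.2 (by omega), rfl⟩))
      · rw [show i + j = (i + j - n) + n by omega, Function.iterate_add_apply, hn, iterate_root]
        exact mem_insert_self _ _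

end ParentTree

/-- The edge joining a vertex to its parent. -/
def ParentTree.edge {V : Type} (R : ParentTree V) (v : V) : Sym2 V := s(v, R.par v)

/-- `R` is the tree `T`, with a root and parent map chosen. -/
structure ParentTree.Represents {V : Type} (R : ParentTree V) (T : SimpleGraph V) : Prop where
  adj_par : ∀ v, v ≠ R.root → T.Adj v (R.par v)
  par_eq_or : ∀ u v, T.Adj u v → (v ≠ R.root ∧ R.par v = u) ∨ (u ≠ R.root ∧ R.par u = v)
  edge_injOn : Set.InjOn R.edge {R.root}ᶜ

namespace SimpleGraph

variable {V : Type} {T : SimpleGraph V}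

lemma IsTree.exists_unique_adj_dist (hT : T.IsTree) {v₀ v : V} (hv : v ≠ v₀) :
    ∃! u, T.Adj u v ∧ T.dist v₀ v = T.dist v₀ u + 1 := by
  obtain ⟨p, hp, hpl⟩ := hT.connected.exists_path_of_dist v₀ v
  have key : ∀ u, T.Adj u v → T.dist v₀ v = T.dist v₀ u + 1 → u = p.penultimate := by
    intro u hu hd
    obtain ⟨r, -, hrl⟩ := hT.connected.exists_path_of_dist v₀ u
    have hc : (r.concat hu).IsPath :=
      Walk.isPath_of_length_eq_dist _ (by rw [Walk.length_concat, hrl, hd])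
    have := (hT.existsUnique_path v₀ v).unique hp hc
    rw [this, Walk.penultimate_concat]
  have hnil : ¬ p.Nil := Walk.not_nil_of_ne hv.symm
  have hadj := p.adj_penultimate hnil
  refine ⟨p.penultimate, ⟨hadj, ?_⟩, fun u hu => key u hu.1 hu.2⟩
  refine (hT.dist_eq_dist_add_one_of_adj v₀ hadj.symm).resolve_right fun h => ?_
  have h1 := dist_le p.dropLast
  have h2 : p.dropLast.length ≤ p.length := by simp
  omega

/-- A locally finite tree can be rooted at any vertex. -/
lemma IsTree.exists_represents (hT : T.IsTree) (v₀ : V) (hfin : ∀ v, (T.neighborSet v).Finite) :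
    ∃ R : ParentTree V, R.root = v₀ ∧ R.Represents T := by
  classical
  choose! par hadj hdist using fun v (hv : v ≠ v₀) => (hT.exists_unique_adj_dist hv).exists
  have hpar : ∀ u v, T.Adj u v → T.dist v₀ v = T.dist v₀ u + 1 → v ≠ v₀ ∧ par v = u := by
    intro u v h hd
    have hv : v ≠ v₀ := by
      rintro rfl
      simp at hd
    exact ⟨hv, (hT.exists_unique_adj_dist hv).unique ⟨hadj v hv, hdist v hv⟩ ⟨h, hd⟩⟩
  have hchfin : ∀ v, {w | w ≠ v₀ ∧ par w = v}.Finite := fun v => (hfin v).subset <| by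
    rintro w ⟨hw, rfl⟩
    exact hadj w hw
  let R : ParentTree V :=
    { root := v₀
      par := fun v => if v = v₀ then v₀ else par v
      ch := fun v => (hchfin v).toFinset
      par_root := if_pos rfl
      mem_ch := fun v w => by
        rw [Set.Finite.mem_toFinset, Set.mem_ofPred_eq]
        exact and_congr_right fun hw => by rw [if_neg hw]
      exists_iterate := fun v => by
        obtain ⟨n, hn⟩ : ∃ n, T.dist v₀ v = n := ⟨_, rfl⟩
        induction n generalizing v with
        | zero => exact ⟨0, (hT.connected.dist_eq_zero_iff.1 hn).symm⟩
        | succ n ih =>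
          have hv : v ≠ v₀ := by
            rintro rfl
            simp at hn
          obtain ⟨i, hi⟩ := ih (par v) (by have := hdist v hv; omega)
          exact ⟨i + 1, by rw [Function.iterate_succ_apply, if_neg hv, hi]⟩ }
  have hRpar : ∀ v, v ≠ v₀ → R.par v = par v := fun v hv => if_neg hv
  refine ⟨R, rfl, ⟨fun v hv => ?_, fun u v h => ?_, fun u hu v hv huv => ?_⟩⟩
  · rw [hRpar v hv]
    exact (hadj v hv).symm
  · refine (hT.dist_eq_dist_add_one_of_adj v₀ h).symm.imp (fun hd => ?_) fun hd => ?_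
    · obtain ⟨h1, h2⟩ := hpar u v h hd
      exact ⟨h1, (hRpar v h1).trans h2⟩
    · obtain ⟨h1, h2⟩ := hpar v u h.symm hd
      exact ⟨h1, (hRpar u h1).trans h2⟩
  · have hu : u ≠ v₀ := hu
    have hv : v ≠ v₀ := hv
    simp only [ParentTree.edge, hRpar u hu, hRpar v hv] at huv
    rcases Sym2.eq_iff.1 huv with h | h
    · exact h.1
    · have h1 := hdist u hu
      have h2 := hdist v hv
      rw [h.2] at h1
      rw [← h.1] at h2
      omega

end SimpleGraph

namespace ParentTree.Represents

variable {V : Type} {R : ParentTree V} {T : SimpleGraph V}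

lemma neighborSet_root (h : R.Represents T) : T.neighborSet R.root = R.ch R.root := by
  ext w
  simp only [SimpleGraph.mem_neighborSet, Finset.mem_coe, R.mem_ch]
  refine ⟨fun hw => (h.par_eq_or _ _ hw).resolve_right fun h' => h'.1 rfl, fun hw => ?_⟩
  rw [← hw.2]
  exact (h.adj_par w hw.1).symm

lemma neighborSet_of_ne (h : R.Represents T) {v : V} (hv : v ≠ R.root) :
    T.neighborSet v = insert (R.par v) (R.ch v : Set V) := by
  ext w
  simp only [SimpleGraph.mem_neighborSet, Set.mem_insert_iff, Finset.mem_coe, R.mem_ch]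
  constructor
  · exact fun hw => (h.par_eq_or _ _ hw).symm.imp (fun h' => h'.2.symm) id
  · rintro (rfl | ⟨hw, rfl⟩)
    · exact h.adj_par v hv
    · exact (h.adj_par w hw).symm

lemma par_notMem_ch (h : R.Represents T) {v : V} (hv : v ≠ R.root) : R.par v ∉ R.ch v := by
  intro hm
  obtain ⟨h1, h2⟩ := (R.mem_ch _ _).1 hm
  have := h.edge_injOn hv h1 (by rw [edge, edge, h2, Sym2.eq_swap])
  exact (h.adj_par v hv).ne this

lemma isBiregular (h : R.Represents T) {S : Set V} {a b : ℕ}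
    (hI : ∀ v ∈ S, T.neighborSet v ⊆ Sᶜ ∧ (T.neighborSet v).ncard = a)
    (hII : ∀ v ∉ S, T.neighborSet v ⊆ S ∧ (T.neighborSet v).ncard = b) :
    R.IsBiregular S a b := by
  have hroot : (T.neighborSet R.root).ncard = (R.ch R.root).card := by
    rw [h.neighborSet_root, Set.ncard_coe_finset]
  have hne : ∀ v, v ≠ R.root → (T.neighborSet v).ncard = (R.ch v).card + 1 := fun v hv => by
    rw [h.neighborSet_of_ne hv, Set.ncard_insert_of_notMem (by simpa using h.par_notMem_ch hv),
      Set.ncard_coe_finset]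
  refine ⟨fun v hv => ?_, ⟨fun hr => ?_, fun hr => ?_⟩, fun v hv hr => ?_, fun v hv hr => ?_⟩
  · have hadj := h.adj_par v hv
    exact ⟨fun hp hvS => (hI v hvS).1 hadj hp, fun hvS => (hII v hvS).1 hadj⟩
  · rw [← hroot, (hI _ hr).2]
  · rw [← hroot, (hII _ hr).2]
  · rw [← hne v hr, (hI v hv).2]
  · rw [← hne v hr, (hII v hv).2]

lemma exists_child (h : R.Represents T) : ∃ child : Sym2 V → V,
    (∀ v, v ≠ R.root → child (R.edge v) = v) ∧
      ∀ e ∈ T.edgeSet, child e ≠ R.root ∧ R.edge (child e) = e := by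
  have hex : ∀ e ∈ T.edgeSet, ∃ v, v ≠ R.root ∧ R.edge v = e := by
    intro e he
    induction e with | h u v
    rcases h.par_eq_or u v he with h' | h'
    · exact ⟨v, h'.1, by rw [edge, h'.2, Sym2.eq_swap]⟩
    · exact ⟨u, h'.1, by rw [edge, h'.2]⟩
  have : Nonempty V := ⟨R.root⟩
  choose! child hc using hex
  refine ⟨child, fun v hv => ?_, hc⟩
  have := hc (R.edge v) (h.adj_par v hv)
  exact h.edge_injOn this.1 hv this.2

variable [DecidableEq V]

/-- If Breaker has deleted every unsafe edge at the cluster, then the component of the root is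
contained in the cluster. -/
lemma comp_subset_cluster (h : R.Represents T) {N B : Finset V} {E : Finset (Sym2 V)}
    (hE : ∀ v ∈ B, R.edge v ∈ E) (hbd : R.boundary N B = ∅) :
    PercGame.comp T R.root E ⊆ R.cluster N := by
  suffices H : ∀ u w, (T.deleteEdges (E : Set (Sym2 V))).Walk u w →
      u ∈ R.cluster N → w ∈ R.cluster N from
    fun w ⟨p⟩ => H _ _ p ParentTree.root_mem_cluster
  intro u w p hu
  induction p with
  | nil => exact hu
  | @cons u v w huv _ ih =>
    refine ih ?_
    rw [SimpleGraph.deleteEdges_adj] at huv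
    rcases h.par_eq_or u v huv.1 with ⟨hv, rfl⟩ | ⟨-, rfl⟩
    · by_contra hvN
      have hvN' : v ∉ N := fun hN =>
        hvN (mem_cluster_iff.2 ⟨Finset.mem_insert_of_mem hN, hu⟩)
      have hvB : v ∉ B := fun hB =>
        huv.2 (by have := hE v hB; rwa [edge, Sym2.eq_swap] at this)
      have := mem_boundary.2 ⟨hv, hu, hvN', hvB⟩
      simp [hbd] at this
    · exact (mem_cluster_iff.1 hu).2

end ParentTree.Represents

/-- **Theorem (Breaker's win on the bi-regular tree, even with a head start for Maker).**
Let `p, q, a, b` be positive integers with `2 ≤ a ≤ b` and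
`p(b-2) - ⌈p/a⌉(b-a) < q`, and let `T` be an infinite bi-regular tree `T_{a,b}` (with
`S` its set of Type I vertices).  Then Breaker has a winning strategy in the
`(p,q)`-percolation game on `(T, v₀)` even if, before the game begins, Maker is allowed
to pre-emptively mark an arbitrary finite set `M₀` of edges of `T` as safe. -/
theorem breaker_wins_on_biregular_tree_with_head_start (a b p q : ℕ) (ha : 2 ≤ a)
    (hab : a ≤ b) (hp : 1 ≤ p) (hq : 1 ≤ q)
    (hpq : (p : ℤ) * ((b : ℤ) - 2) - (((p + a - 1) / a : ℕ) : ℤ) * ((b : ℤ) - (a : ℤ)) < (q : ℤ))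
    {V : Type} [DecidableEq V] (T : SimpleGraph V) [Infinite V]
    (hconn : T.Connected) (hacyc : T.IsAcyclic) (S : Set V)
    (hI : ∀ v ∈ S, T.neighborSet v ⊆ Sᶜ ∧ (T.neighborSet v).ncard = a)
    (hII : ∀ v ∉ S, T.neighborSet v ⊆ S ∧ (T.neighborSet v).ncard = b)
    (v₀ : V) (M₀ : Finset (Sym2 V)) (hM₀ : ↑M₀ ⊆ T.edgeSet) :
    ∃ τ : PercGame.Strategy V, PercGame.BreakerLegal T q τ ∧
      ∀ σ : PercGame.Strategy V, PercGame.MakerLegal T p σ →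
        ∃ n : ℕ, (PercGame.comp T v₀ (PercGame.play σ τ (M₀, ∅) n).2).Finite := by
  classical
  have hfin : ∀ v, (T.neighborSet v).Finite := fun v => by
    by_cases hv : v ∈ S
    · exact Set.finite_of_ncard_pos (by rw [(hI v hv).2]; omega)
    · exact Set.finite_of_ncard_pos (by rw [(hII v hv).2]; omega)
  obtain ⟨R, rfl, hR⟩ := SimpleGraph.IsTree.exists_represents ⟨hconn, hacyc⟩ v₀ hfin
  obtain ⟨child, hchild, hedge⟩ := hR.exists_child
  obtain ⟨N₀, hMN₀, hN₀⟩ := R.exists_superset_subset_cluster (M₀.image child)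
  choose reply hreply using fun N B => R.exists_isGoodReply N B S q
  let τ : PercGame.Strategy V := fun M B =>
    (reply (N₀ ∪ M.image child) (B.image child)).image R.edge
  have hne : ∀ N B, ∀ v ∈ reply N B, v ≠ R.root := fun N B v hv hr =>
    (hreply N B).root_notMem (hr ▸ hv)
  have hτ : PercGame.BreakerLegal T q τ := by
    intro M B
    refine ⟨?_, ?_, ?_⟩
    · rw [Finset.card_image_of_injOn fun u hu v hv => hR.edge_injOn (hne _ _ u hu) (hne _ _ v hv)]
      exact (hreply _ _).card_eq
    · intro e he
      obtain ⟨v, hv, rfl⟩ := Finset.mem_image.1 he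
      exact hR.adj_par v (hne _ _ v hv)
    · rw [Finset.disjoint_left]
      intro e he heMB
      obtain ⟨v, hv, rfl⟩ := Finset.mem_image.1 he
      refine Finset.disjoint_left.1 (hreply _ _).disjoint hv ?_
      simp only [Finset.mem_union, Finset.mem_image] at heMB ⊢
      exact heMB.imp (fun h => .inr ⟨_, h, hchild v (hne _ _ v hv)⟩)
        fun h => ⟨_, h, hchild v (hne _ _ v hv)⟩
  refine ⟨τ, hτ, fun σ hσ => ?_⟩
  let P := PercGame.play σ τ (M₀, ∅)
  let N : ℕ → Finset V := fun t => N₀ ∪ (P t).1.image child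
  let B : ℕ → Finset V := fun t => (P t).2.image child
  have hBedge : ∀ t, ↑(P t).2 ⊆ T.edgeSet := fun t => by
    induction t with
    | zero => simp [P, PercGame.play]
    | succ t ih =>
      simp only [P, PercGame.play, Finset.coe_union]
      exact Set.union_subset ih (hτ _ _).2.1
  have hN0 : N 0 = N₀ := Finset.union_eq_left.2 hMN₀
  have hNsucc : ∀ t, N (t + 1) = N t ∪ (σ (P t).1 (P t).2).image child := fun t => by
    simp only [N, P, PercGame.play, Finset.image_union, Finset.union_assoc]
  have hplay : R.IsPlay S p q N B (fun t => (σ (P t).1 (P t).2).image child)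
      (fun t => reply (N (t + 1)) (B t)) :=
    { mem_cluster := by rw [hN0]; exact hN₀
      B_zero := rfl
      N_succ := hNsucc
      B_succ := fun t => by
        simp only [B, N, P, PercGame.play, Finset.image_union, τ, Finset.image_image]
        congr 1
        exact (Finset.image_congr (g := id) fun v hv => hchild v (hne _ _ v hv)).trans
          Finset.image_id
      card_X := fun t => Finset.card_image_le.trans (hσ _ _).1.le
      disjoint_X := fun t => by
        rw [Finset.disjoint_left]
        intro v hv hvB
        obtain ⟨e, he, rfl⟩ := Finset.mem_image.1 hv
        obtain ⟨e', he', hee'⟩ := Finset.mem_image.1 hvB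
        have := congrArg R.edge hee'
        rw [(hedge e' (hBedge t he')).2, (hedge e ((hσ _ _).2.1 he)).2] at this
        exact Finset.disjoint_left.1 (hσ _ _).2.2 he (Finset.mem_union_right _ (this ▸ he'))
      isGoodReply := fun t => hreply _ _ }
  obtain ⟨t, ht⟩ := hplay.exists_boundary_eq_empty (hR.isBiregular hI hII) ha hab hp hpq
  refine ⟨t, (R.cluster (N t)).finite_toSet.subset (hR.comp_subset_cluster (fun v hv => ?_) ht)⟩
  obtain ⟨e, he, rfl⟩ := Finset.mem_image.1 hv
  rwa [(hedge e (hBedge t he)).2]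
end

section
/- Let (Λ, v₀) be a rooted infinite connected graph and let p, q be positive integers. Maker has a winning strategy in the (p,q)-percolation game on (Λ, v₀) if and only if Maker has a winning strategy in the (p,q)-escape game on (X, Λ, v₀) for every finite connected induced subgraph X of Λ with v₀ ∈ V(X). -/
/-! ### The `(p,q)`-escape game

Given a finite connected induced subgraph `X` (with vertex set `S ∋ v₀`) of an
infinite connected graph `G`, Maker and Breaker alternately claim previously
unclaimed edges of `X`, Maker playing first; Maker claims `p` unclaimed edges per
turn and Breaker claims `q` (or all remaining edges, if fewer are left).  Maker wins
if she claims all edges of a path in `X` from `v₀` to the boundary `∂_G(S)`; Breaker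
wins if he claims at least one edge from every such path (equivalently, if he can
forever prevent Maker from completing such a path). -/

namespace EscapeGame

variable {V : Type} [DecidableEq V]

/-- The edge set of the subgraph of `G` induced by the vertex set `S`. -/
def edgesOf (G : SimpleGraph V) (S : Set V) : Set (Sym2 V) :=
  {e | e ∈ G.edgeSet ∧ ∀ v ∈ e, v ∈ S}

/-- The boundary `∂_G(S)`: vertices of `S` sending an edge of `G` outside of `S`. -/
def boundary (G : SimpleGraph V) (S : Set V) : Set V :=
  {x | x ∈ S ∧ ∃ y, y ∉ S ∧ G.Adj x y}

/-- In the escape game on the subgraph induced by `S`, Maker claims `p` as-yet-unclaimed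
edges of the subgraph per turn (or all remaining ones if fewer than `p` are left). -/
def MakerLegalE (G : SimpleGraph V) (S : Set V) (p : ℕ) (σ : PercGame.Strategy V) : Prop :=
  ∀ M B : Finset (Sym2 V),
    ↑(σ M B) ⊆ edgesOf G S \ ↑(M ∪ B) ∧
    (σ M B).card = min p (edgesOf G S \ ↑(M ∪ B)).ncard

/-- Breaker claims `q` as-yet-unclaimed edges of the subgraph induced by `S` per turn
(or all remaining ones if fewer than `q` are left). -/
def BreakerLegalE (G : SimpleGraph V) (S : Set V) (q : ℕ) (τ : PercGame.Strategy V) : Prop :=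
  ∀ M B : Finset (Sym2 V),
    ↑(τ M B) ⊆ edgesOf G S \ ↑(M ∪ B) ∧
    (τ M B).card = min q (edgesOf G S \ ↑(M ∪ B)).ncard

/-- Maker has a winning strategy in the `(p,q)`-escape game on `(X, G, v₀)`, where `X`
is the subgraph of `G` induced by `S`: she can claim all edges of a path from `v₀` to
the boundary `∂_G(S)`. -/
def MakerWinsE (G : SimpleGraph V) (S : Set V) (v₀ : V) (p q : ℕ) : Prop :=
  ∃ σ : PercGame.Strategy V, MakerLegalE G S p σ ∧
    ∀ τ : PercGame.Strategy V, BreakerLegalE G S q τ →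
      ∃ n : ℕ, ∃ x ∈ boundary G S,
        (SimpleGraph.fromEdgeSet
          (↑(PercGame.play σ τ (∅, ∅) n).1 : Set (Sym2 V))).Reachable v₀ x

/-- Breaker has a winning strategy in the `(p,q)`-escape game on `(X, G, v₀)`: he can
forever prevent Maker from claiming all edges of a path from `v₀` to `∂_G(S)`. -/
def BreakerWinsE (G : SimpleGraph V) (S : Set V) (v₀ : V) (p q : ℕ) : Prop :=
  ∃ τ : PercGame.Strategy V, BreakerLegalE G S q τ ∧
    ∀ σ : PercGame.Strategy V, MakerLegalE G S p σ →
      ∀ n : ℕ, ∀ x ∈ boundary G S,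
        ¬ (SimpleGraph.fromEdgeSet
            (↑(PercGame.play σ τ (∅, ∅) n).1 : Set (Sym2 V))).Reachable v₀ x

end EscapeGame

namespace PercGame

section AbstractGame

variable {α : Type*}

/-- A move `m` claims `k` unclaimed elements of the board `E`, or all the remaining ones if
fewer than `k` are left. -/
def FullMove (E : Set α) (k : ℕ) (C m : Finset α) : Prop :=
  ↑m ⊆ E \ ↑C ∧ m.card ≤ k ∧ (m.card = k ∨ E \ ↑C ⊆ ↑m)

/-- A move of at most `k` unclaimed elements extends to a full move. -/
lemma exists_fullMove_superset (E : Set α) (k : ℕ) (C m₀ : Finset α)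
    (h₀ : ↑m₀ ⊆ E \ ↑C) (hk : m₀.card ≤ k) : ∃ m, m₀ ⊆ m ∧ FullMove E k C m := by
  by_cases hfin : (E \ ↑C).Finite
  · lift E \ ↑C to Finset α using hfin with R hR
    rw [Finset.coe_subset] at h₀
    by_cases hc : R.card ≤ k
    · exact ⟨R, h₀, by simp [FullMove, ← hR, hc]⟩
    · obtain ⟨m, h1, h2, h3⟩ := Finset.exists_subsuperset_card_eq h₀ hk (by omega)
      exact ⟨m, h1, by simpa [← hR] using h2, h3.le, Or.inl h3⟩
  · obtain ⟨m, h1, h2, h3⟩ := Set.Infinite.exists_superset_ncard_eq (t := E \ ↑C) hfin h₀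
      m₀.finite_toSet (k := k) (by simpa using hk)
    by_cases hm : m.Finite
    · lift m to Finset α using hm
      rw [Set.ncard_coe_finset] at h3
      exact ⟨m, by simpa using h1, h2, h3.le, Or.inl h3⟩
    · rw [Set.Infinite.ncard hm] at h3
      exact ⟨m₀, subset_rfl, h₀, hk, Or.inl (by omega)⟩

lemma exists_fullMove (E : Set α) (k : ℕ) (C : Finset α) : ∃ m, FullMove E k C m := by
  obtain ⟨m, -, hm⟩ := exists_fullMove_superset E k C ∅ (by simp) (by simp)
  exact ⟨m, hm⟩

/-- A limit along an ultrafilter of finite sets of bounded size. -/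
lemma exists_ultrafilter_limit {ι : Type*} {p : ℕ} (U : Ultrafilter ι) (m : ι → Finset α)
    (hm : ∀ i, (m i).card ≤ p) :
    ∃ l : Finset α, l.card ≤ p ∧ ∀ e, e ∈ l ↔ ∀ᶠ i in U, e ∈ m i := by
  have key : ∀ F : Finset α, (∀ e ∈ F, ∀ᶠ i in U, e ∈ m i) → F.card ≤ p := by
    intro F hF
    obtain ⟨i, hi⟩ := ((Filter.eventually_all_finset F).2 hF).exists
    exact (Finset.card_le_card hi).trans (hm i)
  have hfin : {e | ∀ᶠ i in U, e ∈ m i}.Finite := by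
    by_contra hinf
    obtain ⟨F, hF, hc⟩ := Set.Infinite.exists_subset_card_eq hinf (p + 1)
    have := key F (fun e he => hF he)
    omega
  exact ⟨hfin.toFinset, key _ (by simp), by simp⟩

variable [DecidableEq α]

/-- The position `(M, B)` is safe for Maker: she can keep `A` true of Breaker's set forever, in
the relaxed game where either player claims any at most `p` (resp. `q`) elements that the
opponent does not own. -/
def Safe (A : Finset α → Prop) (p q : ℕ) (M B : Finset α) : Prop :=
  ∃ W : Set (Finset α × Finset α), (M, B) ∈ W ∧ ∀ M B, (M, B) ∈ W → A B ∧
    ∃ m : Finset α, m.card ≤ p ∧ Disjoint m B ∧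
      ∀ b : Finset α, b.card ≤ q → Disjoint b (M ∪ m) → (M ∪ m, B ∪ b) ∈ W

variable {A A' : Finset α → Prop} {p q : ℕ} {M B M' B' : Finset α}

lemma Safe.alive (h : Safe A p q M B) : A B := by
  obtain ⟨W, hW, h⟩ := h
  exact (h M B hW).1

lemma Safe.exists_move (h : Safe A p q M B) : ∃ m : Finset α, m.card ≤ p ∧ Disjoint m B ∧
    ∀ b : Finset α, b.card ≤ q → Disjoint b (M ∪ m) → Safe A p q (M ∪ m) (B ∪ b) := by
  obtain ⟨W, hW, h⟩ := h
  obtain ⟨m, h1, h2, h3⟩ := (h M B hW).2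
  exact ⟨m, h1, h2, fun b hb hd => ⟨W, h3 b hb hd, h⟩⟩

lemma Safe.imp (h : Safe A p q M B) (hA : ∀ B, A B → A' B) : Safe A' p q M B := by
  obtain ⟨W, hW, h⟩ := h
  exact ⟨W, hW, fun M B hMB => ⟨hA _ (h M B hMB).1, (h M B hMB).2⟩⟩

/-- `A` is inherited by sets meeting `E` in fewer elements. -/
def AntitoneOn (E : Set α) (A : Finset α → Prop) : Prop :=
  ∀ B B' : Finset α, (∀ e ∈ B', e ∈ E → e ∈ B) → A B → A B'

/-- Safety only depends on the part of the position on the board, and is monotone there. -/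
lemma Safe.transfer {E : Set α} (hE : AntitoneOn E A) (h : Safe A p q M B)
    (hM : ∀ e ∈ M, e ∈ E → e ∈ M') (hB : ∀ e ∈ B', e ∈ E → e ∈ B) : Safe A p q M' B' := by
  classical
  refine ⟨{P | ∃ M B, Safe A p q M B ∧ (∀ e ∈ M, e ∈ E → e ∈ P.1) ∧
    (∀ e ∈ P.2, e ∈ E → e ∈ B)}, ⟨M, B, h, hM, hB⟩, ?_⟩
  rintro M' B' ⟨M, B, h, hM, hB⟩
  refine ⟨hE _ _ hB h.alive, ?_⟩
  obtain ⟨m, h1, h2, h3⟩ := h.exists_move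
  refine ⟨m.filter (· ∈ E), (Finset.card_filter_le _ _).trans h1, ?_, fun b hb hd => ?_⟩
  · rw [Finset.disjoint_left] at h2 ⊢
    intro e he he'
    rw [Finset.mem_filter] at he
    exact h2 he.1 (hB e he' he.2)
  · refine ⟨_, _, h3 (b.filter (· ∈ E)) ((Finset.card_filter_le _ _).trans hb) ?_, ?_, ?_⟩
    · rw [Finset.disjoint_left] at hd ⊢
      intro e he he'
      have := hM e
      have := @hd e
      simp only [Finset.mem_filter, Finset.mem_union] at *
      tauto
    · intro e he he'
      have := hM e
      simp only [Finset.mem_filter, Finset.mem_union] at *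
      tauto
    · intro e he he'
      have := hB e
      simp only [Finset.mem_filter, Finset.mem_union] at *
      tauto

/-- In a safe position Maker has a full move preserving safety against all full replies. -/
lemma Safe.exists_fullMove {E : Set α} (hE : AntitoneOn E A) (h : Safe A p q M B) :
    ∃ m, FullMove E p (M ∪ B) m ∧
      ∀ b, FullMove E q ((M ∪ m) ∪ B) b → Safe A p q (M ∪ m) (B ∪ b) := by
  classical
  obtain ⟨m₀, h1, h2, h3⟩ := h.exists_move
  obtain ⟨m, hm, hfull⟩ := exists_fullMove_superset E p (M ∪ B) ((m₀.filter (· ∈ E)) \ M)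
    (by
      intro e he
      have : e ∈ m₀ → e ∉ B := fun h => Finset.disjoint_left.1 h2 h
      simp only [Finset.coe_sdiff, Finset.coe_filter, Set.mem_sdiff, Set.mem_ofPred_eq,
        Finset.mem_coe, Finset.mem_union] at *
      tauto)
    ((Finset.card_le_card Finset.sdiff_subset).trans ((Finset.card_filter_le _ _).trans h1))
  have key : ∀ e ∈ M ∪ m₀, e ∈ E → e ∈ M ∪ m := by
    intro e he heE
    have := @hm e
    simp only [Finset.mem_sdiff, Finset.mem_filter, Finset.mem_union] at *
    tauto
  refine ⟨m, hfull, fun b hb => ?_⟩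
  refine (h3 b hb.2.1 ?_).transfer hE key (fun e he _ => he)
  rw [Finset.disjoint_left]
  intro e he he'
  have hbe := hb.1 he
  exact hbe.2 (Finset.mem_coe.2 (Finset.mem_union_left _ (key e he' hbe.1)))

/-- Compactness: if the condition `A` is the conjunction of a directed family of conditions, each
depending on finitely many elements, and each can be maintained by Maker, then so can `A`. -/
lemma safe_of_forall_safe {ι : Type*} [SemilatticeSup ι] [Nonempty ι]
    {A : ι → Finset α → Prop} {A' : Finset α → Prop} {E : ι → Set α}
    (hfin : ∀ i, (E i).Finite) (hE : ∀ i, AntitoneOn (E i) (A i))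
    (hanti : ∀ i j, i ≤ j → ∀ B, A j B → A i B) (hA : ∀ B, (∀ i, A i B) → A' B)
    (h : ∀ i, Safe (A i) p q M B) : Safe A' p q M B := by
  refine ⟨{P | ∀ i, Safe (A i) p q P.1 P.2}, h, fun M B hMB => ?_⟩
  have hMB : ∀ i, Safe (A i) p q M B := hMB
  refine ⟨hA _ fun i => (hMB i).alive, ?_⟩
  choose m h1 h2 h3 using fun i => (hMB i).exists_move
  let U : Ultrafilter ι := Ultrafilter.of Filter.atTop
  obtain ⟨l, hl, hmem⟩ := exists_ultrafilter_limit U m h1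
  refine ⟨l, hl, ?_, fun b hb hd i => ?_⟩
  · rw [Finset.disjoint_left]
    intro e he heB
    obtain ⟨i, hi⟩ := ((hmem e).1 he).exists
    exact Finset.disjoint_left.1 (h2 i) hi heB
  · have hge : ∀ᶠ j in U, i ≤ j := Ultrafilter.of_le _ (Filter.eventually_ge_atTop i)
    have hnot : ∀ e, e ∉ l → ∀ᶠ j in U, e ∉ m j := fun e he =>
      Ultrafilter.eventually_not.2 (fun h => he ((hmem e).2 h))
    have hEi : ∀ᶠ j in U, ∀ e ∈ E i, e ∈ m j → e ∈ l := by
      refine (Filter.eventually_all_finite (hfin i)).2 fun e _ => ?_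
      by_cases he : e ∈ l
      · exact Filter.Eventually.of_forall fun _ _ => he
      · exact (hnot e he).mono fun j hj hj' => absurd hj' hj
    have hbj : ∀ᶠ j in U, ∀ e ∈ b, e ∉ m j := by
      refine (Filter.eventually_all_finset b).2 fun e he => hnot e fun hel => ?_
      exact Finset.disjoint_left.1 hd he (Finset.mem_union_right _ hel)
    obtain ⟨j, hij, hj, hbj⟩ := (hge.and (hEi.and hbj)).exists
    refine Safe.transfer (hE i) ((h3 j b hb ?_).imp (hanti i j hij)) ?_ (fun e he _ => he)
    · rw [Finset.disjoint_left] at hd ⊢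
      intro e he he'
      rcases Finset.mem_union.1 he' with h | h
      · exact hd he (Finset.mem_union_left _ h)
      · exact hbj e he h
    · intro e he heE
      rcases Finset.mem_union.1 he with h | h
      · exact Finset.mem_union_left _ h
      · exact Finset.mem_union_right _ (hj e heE h)

end AbstractGame

section Strategies

variable {V : Type} [DecidableEq V]

/-- The strategy always makes full moves on the board `E`. -/
def FullStrategy (E : Set (Sym2 V)) (k : ℕ) (σ : Strategy V) : Prop :=
  ∀ M B, FullMove E k (M ∪ B) (σ M B)

lemma exists_fullStrategy (E : Set (Sym2 V)) (k : ℕ) : ∃ σ : Strategy V, FullStrategy E k σ := by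
  choose f hf using exists_fullMove E k
  exact ⟨fun M B => f (M ∪ B), fun M B => hf _⟩

lemma play_succ_eq_play (σ τ : Strategy V) (P : Finset (Sym2 V) × Finset (Sym2 V)) (n : ℕ) :
    play σ τ P (n + 1) = play σ τ (P.1 ∪ σ P.1 P.2, P.2 ∪ τ (P.1 ∪ σ P.1 P.2) P.2) n := by
  induction n with
  | zero => rfl
  | succ n ih => rw [play, ih]; rfl

lemma play_mono (σ τ : Strategy V) (P : Finset (Sym2 V) × Finset (Sym2 V)) :
    Monotone (play σ τ P) :=
  monotone_nat_of_le_succ fun _ => ⟨Finset.subset_union_left, Finset.subset_union_left⟩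

lemma play_congr {σ τ τ' : Strategy V} {P : Finset (Sym2 V) × Finset (Sym2 V)}
    (h : ∀ M B, P.2 ⊆ B → τ M B = τ' M B) (n : ℕ) : play σ τ P n = play σ τ' P n := by
  induction n with
  | zero => rfl
  | succ n ih =>
    have := h ((play σ τ' P n).1 ∪ σ (play σ τ' P n).1 (play σ τ' P n).2) (play σ τ' P n).2
      (play_mono σ τ' P (Nat.zero_le n)).2
    simp only [play, ih, this]

variable {E : Set (Sym2 V)} {A : Finset (Sym2 V) → Prop} {p q : ℕ}

/-- A safe initial position yields a positional strategy keeping `A` true. -/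
lemma exists_strategy_of_safe (hE : AntitoneOn E A) (h : Safe A p q ∅ ∅) :
    ∃ σ, FullStrategy E p σ ∧ ∀ τ, FullStrategy E q τ → ∀ n, A (play σ τ (∅, ∅) n).2 := by
  have hex : ∀ M B : Finset (Sym2 V), ∃ m, FullMove E p (M ∪ B) m ∧ (Safe A p q M B →
      ∀ b, FullMove E q ((M ∪ m) ∪ B) b → Safe A p q (M ∪ m) (B ∪ b)) := by
    intro M B
    by_cases hs : Safe A p q M B
    · obtain ⟨m, h1, h2⟩ := hs.exists_fullMove hE
      exact ⟨m, h1, fun _ => h2⟩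
    · obtain ⟨m, hm⟩ := exists_fullMove E p (M ∪ B)
      exact ⟨m, hm, fun h => absurd h hs⟩
  choose σ hσ1 hσ2 using hex
  refine ⟨σ, hσ1, fun τ hτ n => ?_⟩
  suffices Safe A p q (play σ τ (∅, ∅) n).1 (play σ τ (∅, ∅) n).2 from this.alive
  induction n with
  | zero => exact h
  | succ n ih => exact hσ2 _ _ ih _ (hτ _ _)

/-- If a strategy keeps `A` true from `(M, B)`, it does so from every position one round later. -/
lemma alive_after_round (hq : 1 ≤ q) {σ : Strategy V} {M B b : Finset (Sym2 V)}
    (h : ∀ τ, FullStrategy E q τ → ∀ n, A (play σ τ (M, B) n).2)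
    (hb : FullMove E q ((M ∪ σ M B) ∪ B) b) :
    ∀ τ, FullStrategy E q τ → ∀ n, A (play σ τ (M ∪ σ M B, B ∪ b) n).2 := by
  intro τ hτ n
  let τ' : Strategy V := fun M₁ B₁ => if M₁ = M ∪ σ M B ∧ B₁ = B then b else τ M₁ B₁
  have hτ' : FullStrategy E q τ' := by
    intro M₁ B₁
    by_cases hc : M₁ = M ∪ σ M B ∧ B₁ = B
    · simp only [τ', if_pos hc]
      rwa [hc.1, hc.2]
    · simp only [τ', if_neg hc]
      exact hτ _ _
  have hτb : τ' (M ∪ σ M B) B = b := if_pos ⟨rfl, rfl⟩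
  have := h τ' hτ' (n + 1)
  rw [play_succ_eq_play] at this
  simp only [hτb] at this
  rwa [play_congr (τ' := τ)] at this
  intro M₁ B₁ hsub
  by_cases hc : M₁ = M ∪ σ M B ∧ B₁ = B
  · obtain ⟨rfl, rfl⟩ := hc
    have hb0 : b = ∅ := by
      rw [Finset.eq_empty_iff_forall_notMem]
      intro e he
      exact (hb.1 he).2 (Finset.mem_coe.2 (Finset.mem_union_right _
        (hsub (Finset.mem_union_right _ he))))
    have hrem : E \ ↑((M ∪ σ M B₁) ∪ B₁) ⊆ (↑b : Set (Sym2 V)) := by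
      refine hb.2.2.resolve_left fun hc => ?_
      rw [hb0, Finset.card_empty] at hc
      omega
    rw [hτb, hb0, eq_comm, Finset.eq_empty_iff_forall_notMem]
    intro e he
    have := hrem ((hτ _ _).1 he)
    simp [hb0] at this
  · exact if_neg hc

/-- A strategy keeping `A` true witnesses that the initial position is safe. -/
lemma safe_of_strategy (hq : 1 ≤ q) (hE : AntitoneOn E A) {σ : Strategy V}
    (hσ : FullStrategy E p σ)
    (h : ∀ τ, FullStrategy E q τ → ∀ n, A (play σ τ (∅, ∅) n).2) : Safe A p q ∅ ∅ := by
  classical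
  obtain ⟨τ₀, hτ₀⟩ := exists_fullStrategy E q
  refine ⟨{P | ∃ M B, (∀ τ, FullStrategy E q τ → ∀ n, A (play σ τ (M, B) n).2) ∧
    (∀ e ∈ M, e ∈ E → e ∈ P.1) ∧ (∀ e ∈ P.2, e ∈ E → e ∈ B)},
    ⟨∅, ∅, h, by simp, by simp⟩, ?_⟩
  rintro M' B' ⟨M, B, h, hM, hB⟩
  refine ⟨hE _ _ hB (h τ₀ hτ₀ 0), σ M B, (hσ M B).2.1, ?_, fun b' hb' hd => ?_⟩
  · rw [Finset.disjoint_left]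
    intro e he he'
    have := (hσ M B).1 he
    exact this.2 (Finset.mem_coe.2 (Finset.mem_union_right _ (hB e he' this.1)))
  · obtain ⟨b, hbb, hb⟩ := exists_fullMove_superset E q ((M ∪ σ M B) ∪ B)
      ((b'.filter (· ∈ E)) \ B)
      (by
        intro e he
        have : e ∈ b' → e ∉ M' ∪ σ M B := fun h => Finset.disjoint_left.1 hd h
        have := hM e
        simp only [Finset.coe_sdiff, Finset.coe_filter, Set.mem_sdiff, Set.mem_ofPred_eq,
          Finset.mem_coe, Finset.mem_union] at *
        tauto)
      ((Finset.card_le_card Finset.sdiff_subset).trans ((Finset.card_filter_le _ _).trans hb'))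
    refine ⟨M ∪ σ M B, B ∪ b, alive_after_round hq h hb, ?_, ?_⟩
    · intro e he he'
      have := hM e
      simp only [Finset.mem_union] at *
      tauto
    · intro e he he'
      have := hB e
      have := @hbb e
      simp only [Finset.mem_sdiff, Finset.mem_filter, Finset.mem_union] at *
      tauto

lemma exists_strategy_iff_safe (hq : 1 ≤ q) (hE : AntitoneOn E A) :
    (∃ σ, FullStrategy E p σ ∧ ∀ τ, FullStrategy E q τ → ∀ n, A (play σ τ (∅, ∅) n).2) ↔
      Safe A p q ∅ ∅ :=
  ⟨fun ⟨_, hσ, h⟩ => safe_of_strategy hq hE hσ h, exists_strategy_of_safe hE⟩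

variable {σ τ : Strategy V}

lemma play_subset_and_disjoint (hσ : FullStrategy E p σ) (hτ : FullStrategy E q τ) (n : ℕ) :
    ↑(play σ τ (∅, ∅) n).1 ⊆ E ∧ Disjoint (play σ τ (∅, ∅) n).1 (play σ τ (∅, ∅) n).2 := by
  induction n with
  | zero => simp [play]
  | succ n ih =>
    obtain ⟨h1, h2⟩ := ih
    set M := (play σ τ (∅, ∅) n).1 with hM
    set B := (play σ τ (∅, ∅) n).2 with hB
    have hm := (hσ M B).1
    have hb := (hτ (M ∪ σ M B) B).1
    have e1 : (play σ τ (∅, ∅) (n + 1)).1 = M ∪ σ M B := rfl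
    have e2 : (play σ τ (∅, ∅) (n + 1)).2 = B ∪ τ (M ∪ σ M B) B := rfl
    rw [e1, e2]
    constructor
    · rw [Finset.coe_union]
      exact Set.union_subset h1 fun e he => (hm he).1
    · rw [Finset.disjoint_left] at h2 ⊢
      intro e he he'
      have := @h2 e
      have := @hm e
      have := @hb e
      simp only [Finset.mem_union, Set.mem_sdiff, Finset.mem_coe] at *
      tauto

/-- On a finite board all elements are eventually claimed. -/
lemma exists_board_claimed (hp : 1 ≤ p) (hfin : E.Finite) (hσ : FullStrategy E p σ)
    (hτ : FullStrategy E q τ) :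
    ∃ n, ∀ e ∈ E, e ∉ (play σ τ (∅, ∅) n).2 → e ∈ (play σ τ (∅, ∅) n).1 := by
  by_contra! hne
  have hcard : ∀ n, n ≤ (play σ τ (∅, ∅) n).1.card := by
    intro n
    induction n with
    | zero => simp
    | succ n ih =>
      set M := (play σ τ (∅, ∅) n).1 with hM
      set B := (play σ τ (∅, ∅) n).2 with hB
      have e1 : (play σ τ (∅, ∅) (n + 1)).1 = M ∪ σ M B := rfl
      have hm := hσ M B
      have hdisj : Disjoint M (σ M B) := by
        rw [Finset.disjoint_right]
        intro e he heM
        exact (hm.1 he).2 (Finset.mem_coe.2 (Finset.mem_union_left _ heM))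
      have hpos : 0 < (σ M B).card := by
        rcases hm.2.2 with h | h
        · omega
        · obtain ⟨e, heE, heB, heM⟩ := hne n
          refine Finset.card_pos.2 ⟨e, Finset.mem_coe.1 (h ⟨heE, fun h' => ?_⟩)⟩
          rcases Finset.mem_union.1 (Finset.mem_coe.1 h') with h' | h'
          · exact heM h'
          · exact heB h'
      rw [e1, Finset.card_union_of_disjoint hdisj]
      omega
  have h1 := hcard (hfin.toFinset.card + 1)
  have h2 : (play σ τ (∅, ∅) (hfin.toFinset.card + 1)).1.card ≤ hfin.toFinset.card :=
    Finset.card_le_card fun e he =>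
      hfin.mem_toFinset.2 ((play_subset_and_disjoint hσ hτ _).1 he)
  omega

end Strategies

section Percolation

variable {V : Type} {G : SimpleGraph V} {v₀ : V}

lemma antitoneOn_comp_infinite :
    AntitoneOn G.edgeSet fun B => (comp G v₀ B).Infinite := by
  intro B B' h hB
  refine hB.mono fun w hw => SimpleGraph.Reachable.mono ?_ hw
  intro x y hxy
  rw [SimpleGraph.deleteEdges_adj] at hxy ⊢
  exact ⟨hxy.1, fun h' => hxy.2 (h _ h' hxy.1)⟩

/-- An infinite connected graph has infinitely many edges. -/
lemma edgeSet_infinite_s7 [Infinite V] (hconn : G.Connected) : G.edgeSet.Infinite := by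
  intro hfin
  have hcov : (Set.univ : Set V) ⊆ ⋃ e ∈ G.edgeSet, {v | v ∈ e} := by
    intro v _
    obtain ⟨w, hw⟩ := hconn.preconnected.exists_adj_of_nontrivial v
    exact Set.mem_biUnion (x := s(v, w)) hw (Sym2.mem_mk_left v w)
  refine Set.infinite_univ ((hfin.biUnion fun e _ => ?_).subset hcov)
  induction e with
  | _ x y => exact (Set.toFinite {x, y}).subset fun v hv => by simpa using hv

variable [DecidableEq V]

lemma legal_iff_fullStrategy (hinf : G.edgeSet.Infinite) (k : ℕ) (σ : Strategy V) :
    MakerLegal G k σ ↔ FullStrategy G.edgeSet k σ := by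
  refine forall₂_congr fun M B => ⟨fun ⟨h1, h2, h3⟩ => ⟨?_, h1.le, Or.inl h1⟩,
    fun ⟨h1, h2, h3⟩ => ⟨?_, ?_, ?_⟩⟩
  · exact Set.subset_sdiff.2 ⟨h2, by exact_mod_cast h3⟩
  · refine h3.resolve_right fun h => ?_
    exact (hinf.sdiff (M ∪ B).finite_toSet) ((σ M B).finite_toSet.subset h)
  · exact h1.trans Set.sdiff_subset
  · exact_mod_cast (Set.subset_sdiff.1 h1).2

lemma makerWins_iff_safe [Infinite V] (hconn : G.Connected) {p q : ℕ} (hq : 1 ≤ q) :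
    MakerWins G v₀ p q ↔ Safe (fun B => (comp G v₀ B).Infinite) p q ∅ ∅ := by
  rw [← exists_strategy_iff_safe hq antitoneOn_comp_infinite]
  have hinf := edgeSet_infinite_s7 hconn
  refine exists_congr fun σ => and_congr (legal_iff_fullStrategy hinf p σ)
    (forall_congr' fun τ => imp_congr_left (legal_iff_fullStrategy hinf q τ))

end Percolation

end PercGame

namespace EscapeGame

open PercGame

variable {V : Type} {G : SimpleGraph V} {v₀ : V} {S T : Set V}
  {B : Finset (Sym2 V)}

/-- Breaker's edges do not separate `v₀` from the boundary of `S` within `S`. -/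
def Unblocked (G : SimpleGraph V) (v₀ : V) (S : Set V) (B : Finset (Sym2 V)) : Prop :=
  ∃ x ∈ boundary G S, (SimpleGraph.fromEdgeSet (edgesOf G S \ ↑B)).Reachable v₀ x

lemma antitoneOn_unblocked : AntitoneOn (edgesOf G S) (Unblocked G v₀ S) := by
  rintro B B' h ⟨x, hx, hr⟩
  refine ⟨x, hx, hr.mono (SimpleGraph.fromEdgeSet_mono ?_)⟩
  exact fun e he => ⟨he.1, fun he' => he.2 (h e he' he.1)⟩

lemma edgesOf_finite (hS : S.Finite) : (edgesOf G S).Finite := by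
  refine hS.toFinset.sym2.finite_toSet.subset fun e he => ?_
  exact Finset.mem_coe.2 (Finset.mem_sym2_iff.2 fun v hv => hS.mem_toFinset.2 (he.2 v hv))

lemma fromEdgeSet_edgesOf_le :
    SimpleGraph.fromEdgeSet (edgesOf G S \ ↑B) ≤ G.deleteEdges (↑B : Set (Sym2 V)) := by
  intro x y h
  rw [SimpleGraph.fromEdgeSet_adj] at h
  rw [SimpleGraph.deleteEdges_adj]
  exact ⟨h.1.1.1, h.1.2⟩

/-- A walk avoiding `B` that starts in `S` and leaves it, or ends at its boundary, contains a
walk inside `S` to the boundary. -/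
lemma unblocked_of_walk {u w : V} (W : (G.deleteEdges (↑B : Set (Sym2 V))).Walk u w) (hu : u ∈ S)
    (hw : w ∈ S → w ∈ boundary G S) : Unblocked G u S B := by
  induction W with
  | nil => exact ⟨_, hw hu, SimpleGraph.Reachable.refl _⟩
  | @cons u v w h W ih =>
    rw [SimpleGraph.deleteEdges_adj] at h
    by_cases hv : v ∈ S
    · obtain ⟨x, hx, hr⟩ := ih hv hw
      refine ⟨x, hx, SimpleGraph.Reachable.trans (SimpleGraph.Adj.reachable ?_) hr⟩
      rw [SimpleGraph.fromEdgeSet_adj]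
      refine ⟨⟨⟨h.1, ?_⟩, h.2⟩, h.1.ne⟩
      simp [hu, hv]
    · exact ⟨u, ⟨hu, v, hv, h.1⟩, SimpleGraph.Reachable.refl _⟩

lemma unblocked_of_comp_infinite (hS : S.Finite) (hv : v₀ ∈ S) (h : (comp G v₀ B).Infinite) :
    Unblocked G v₀ S B := by
  obtain ⟨w, ⟨W⟩, hwS⟩ := h.exists_notMem_finite hS
  exact unblocked_of_walk W hv fun h => absurd h hwS

lemma Unblocked.anti (hST : S ⊆ T) (hv : v₀ ∈ S) (h : Unblocked G v₀ T B) : Unblocked G v₀ S B := by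
  obtain ⟨x, ⟨hxT, y, hy, hxy⟩, hr⟩ := h
  obtain ⟨W⟩ := hr.mono fromEdgeSet_edgesOf_le
  exact unblocked_of_walk W hv fun hx => ⟨hx, y, fun h => hy (hST h), hxy⟩

variable [DecidableEq V]

lemma comp_infinite_of_forall_unblocked
    (h : ∀ S : Finset V, Unblocked G v₀ (insert v₀ ↑S) B) : (comp G v₀ B).Infinite := by
  intro hfin
  obtain ⟨x, ⟨-, y, hy, hxy⟩, hr⟩ := h (hfin.toFinset ∪ B.biUnion Sym2.toFinset)
  have hx : x ∈ comp G v₀ B := hr.mono fromEdgeSet_edgesOf_le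
  refine hy (Set.mem_insert_of_mem _ ?_)
  by_cases hB : s(x, y) ∈ B
  · refine Finset.mem_coe.2 (Finset.mem_union_right _ (Finset.mem_biUnion.2 ⟨_, hB, ?_⟩))
    simp
  · refine Finset.mem_coe.2 (Finset.mem_union_left _ (hfin.mem_toFinset.2 ?_))
    refine SimpleGraph.Reachable.trans hx (SimpleGraph.Adj.reachable ?_)
    rw [SimpleGraph.deleteEdges_adj]
    exact ⟨hxy, hB⟩

lemma legal_iff_fullStrategy (hS : S.Finite) (k : ℕ) (σ : Strategy V) :
    MakerLegalE G S k σ ↔ FullStrategy (edgesOf G S) k σ := by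
  refine forall₂_congr fun M B => and_congr_right fun hsub => ?_
  have hfin : (edgesOf G S \ ↑(M ∪ B)).Finite := (edgesOf_finite hS).sdiff
  have hle := Set.ncard_le_ncard hsub hfin
  rw [Set.ncard_coe_finset] at hle
  constructor
  · intro h
    refine ⟨h ▸ min_le_left _ _, ?_⟩
    rcases min_choice k (edgesOf G S \ ↑(M ∪ B)).ncard with h' | h'
    · exact Or.inl (h.trans h')
    · refine Or.inr (Set.eq_of_subset_of_ncard_le hsub ?_ hfin).ge
      rw [Set.ncard_coe_finset]
      omega
  · rintro ⟨h1, h2 | h2⟩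
    · omega
    · rw [← hsub.antisymm h2, Set.ncard_coe_finset]
      omega

lemma makerWinsE_iff_safe (hS : S.Finite) {p q : ℕ} (hp : 1 ≤ p) (hq : 1 ≤ q) :
    MakerWinsE G S v₀ p q ↔ Safe (Unblocked G v₀ S) p q ∅ ∅ := by
  rw [← exists_strategy_iff_safe hq antitoneOn_unblocked]
  refine exists_congr fun σ => ?_
  rw [legal_iff_fullStrategy hS]
  refine and_congr_right fun hσ => forall_congr' fun τ => ?_
  rw [show BreakerLegalE G S q τ ↔ FullStrategy (edgesOf G S) q τ from
    legal_iff_fullStrategy hS q τ]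
  refine forall_congr' fun hτ => ⟨?_, fun h => ?_⟩
  · rintro ⟨n, x, hx, hr⟩ k
    refine ⟨x, hx, hr.mono (SimpleGraph.fromEdgeSet_mono fun e he => ?_)⟩
    refine ⟨(play_subset_and_disjoint hσ hτ n).1 he, fun hek => ?_⟩
    exact Finset.disjoint_left.1 (play_subset_and_disjoint hσ hτ (max n k)).2
      ((play_mono σ τ _ (le_max_left n k)).1 he) ((play_mono σ τ _ (le_max_right n k)).2 hek)
  · obtain ⟨n, hn⟩ := exists_board_claimed hp (edgesOf_finite hS) hσ hτ
    obtain ⟨x, hx, hr⟩ := h n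
    exact ⟨n, x, hx, hr.mono (SimpleGraph.fromEdgeSet_mono fun e he => hn e he.1 he.2)⟩

end EscapeGame

/-- **Theorem (compactness).**
Let `(Λ, v₀)` be a rooted infinite connected graph and `p, q` positive integers.
Maker has a winning strategy in the `(p,q)`-percolation game on `(Λ, v₀)` if and only
if Maker has a winning strategy in the `(p,q)`-escape game on `(X, Λ, v₀)` for every
finite connected induced subgraph `X` of `Λ` containing `v₀`. -/
theorem maker_wins_percolation_iff_wins_all_escape_games
    {V : Type} [DecidableEq V] (Λ : SimpleGraph V) [Infinite V] (hconn : Λ.Connected)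
    (v₀ : V) (p q : ℕ) (hp : 1 ≤ p) (hq : 1 ≤ q) :
    PercGame.MakerWins Λ v₀ p q ↔
      ∀ S : Set V, S.Finite → v₀ ∈ S → (Λ.induce S).Connected →
        EscapeGame.MakerWinsE Λ S v₀ p q := by
  rw [PercGame.makerWins_iff_safe hconn hq]
  constructor
  · intro h S hS hv _
    rw [EscapeGame.makerWinsE_iff_safe hS hp hq]
    exact h.imp fun B => EscapeGame.unblocked_of_comp_infinite hS hv
  · intro h
    refine PercGame.safe_of_forall_safe (ι := Finset V)
      (A := fun S => EscapeGame.Unblocked Λ v₀ (insert v₀ ↑S))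
      (E := fun S => EscapeGame.edgesOf Λ (insert v₀ ↑S))
      (fun S => EscapeGame.edgesOf_finite (S.finite_toSet.insert v₀))
      (fun S => EscapeGame.antitoneOn_unblocked)
      (fun S T hST B => EscapeGame.Unblocked.anti
        (Set.insert_subset_insert (Finset.coe_subset.2 hST)) (Set.mem_insert _ _))
      (fun B => EscapeGame.comp_infinite_of_forall_unblocked) fun S => ?_
    obtain ⟨T, hST, hT⟩ := SimpleGraph.extend_finset_to_connected hconn.preconnected
      (Finset.insert_nonempty v₀ S)
    have hv : v₀ ∈ (T : Set V) := hST (Finset.mem_insert_self _ _)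
    have hsub : insert v₀ (S : Set V) ⊆ T := by exact_mod_cast hST
    have hwin := h T T.finite_toSet hv hT
    rw [EscapeGame.makerWinsE_iff_safe T.finite_toSet hp hq] at hwin
    exact hwin.imp fun B => EscapeGame.Unblocked.anti hsub (Set.mem_insert _ _)
end
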